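/- arXiv:1107.1015 — 2 statements merged into one kernel-verified Lean document; each statement's English description precedes it below -/
import Mathlib

section
/- Let A be an N×N Hermitian matrix whose eigenvalues form an arithmetic progression: there is ℏ > 0 with a_i = a_1 + (i−1)ℏ for 1 ≤ i ≤ N. Let B be an N×N Hermitian matrix with distinct eigenvalues b_1 < ⋯ < b_N. Then for z ∈ ℂ, I_N(z;A,B) = 0 if and only if z = (2kπ/(Nℏ(b_j − b_i)))·√−1 for some indices 1 ≤ i < j ≤ N and some nonzero integer k; in particular all zeros of I_N(·;A,B) are pure imaginary. -/
open MeasureTheory Matrix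

namespace HCIZ

noncomputable instance (N : ℕ) : MeasurableSpace (Matrix (Fin N) (Fin N) ℂ) := borel _

instance (N : ℕ) : BorelSpace (Matrix (Fin N) (Fin N) ℂ) := ⟨rfl⟩

/-- The number of cycles of a permutation (fixed points counted as cycles). -/
def cycleCount {d : ℕ} (π : Equiv.Perm (Fin d)) : ℕ := π.partition.parts.card

/-- `π` has cycle type `α` (1-cycles included). -/
def HasCycleType {d : ℕ} (π : Equiv.Perm (Fin d)) (α : d.Partition) : Prop :=
  π.partition.parts = α.parts

/-- The tuple `τ` consists of transpositions `(s_i t_i)`, `s_i < t_i`, with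
`t_1 ≤ t_2 ≤ ⋯` (monotone condition). -/
def IsMonotoneTuple {d r : ℕ} (τ : Fin r → Equiv.Perm (Fin d)) : Prop :=
  (∀ i, (τ i).IsSwap) ∧ Monotone fun i => (τ i).support.max

/-- The subgroup generated by `s` acts transitively on `Fin d`. -/
def GeneratesTransitively {d : ℕ} (s : Set (Equiv.Perm (Fin d))) : Prop :=
  ∀ x y : Fin d, ∃ g ∈ Subgroup.closure s, g x = y

/-- `H⃗^r(α,β)`: the number of monotone transitive factorizations of the identity
into `ρ σ τ_1 ⋯ τ_r` with `ρ` of cycle type `α` and `σ` of cycle type `β`. -/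
noncomputable def Hr (d : ℕ) (α β : d.Partition) (r : ℕ) : ℕ :=
  Nat.card {T : Equiv.Perm (Fin d) × Equiv.Perm (Fin d) × (Fin r → Equiv.Perm (Fin d)) //
    HasCycleType T.1 α ∧ HasCycleType T.2.1 β ∧ IsMonotoneTuple T.2.2 ∧
    T.1 * T.2.1 * (List.ofFn T.2.2).prod = 1 ∧
    GeneratesTransitively ({T.1, T.2.1} ∪ Set.range T.2.2)}

/-- `H̃^r(α,β)`: the same count without the transitivity requirement. -/
noncomputable def Hnt (d : ℕ) (α β : d.Partition) (r : ℕ) : ℕ :=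
  Nat.card {T : Equiv.Perm (Fin d) × Equiv.Perm (Fin d) × (Fin r → Equiv.Perm (Fin d)) //
    HasCycleType T.1 α ∧ HasCycleType T.2.1 β ∧ IsMonotoneTuple T.2.2 ∧
    T.1 * T.2.1 * (List.ofFn T.2.2).prod = 1}

/-- The monotone double Hurwitz number `H⃗_g(α,β) = H⃗^r(α,β)`,
`r = 2g - 2 + ℓ(α) + ℓ(β)`. -/
noncomputable def Hg (d g : ℕ) (α β : d.Partition) : ℕ :=
  Hr d α β (2 * g + α.parts.card + β.parts.card - 2)

/-- `m_r(π)`: monotone (not necessarily transitive) factorizations of `π`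
into `r` transpositions. -/
noncomputable def mcount (d r : ℕ) (π : Equiv.Perm (Fin d)) : ℕ :=
  Nat.card {τ : Fin r → Equiv.Perm (Fin d) //
    IsMonotoneTuple τ ∧ (List.ofFn τ).prod = π}

/-- Power sum `p_α(A) = ∏ Tr(A^{α_i})`. -/
noncomputable def pPoly {N : ℕ} (A : Matrix (Fin N) (Fin N) ℂ) {d : ℕ} (α : d.Partition) : ℂ :=
  (α.parts.map fun k => (A ^ k).trace).prod

/-- `φ_α = ∏ φ_{α_i}`. -/
noncomputable def momProd (Φ : ℕ → ℂ) {d : ℕ} (α : d.Partition) : ℂ :=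
  (α.parts.map Φ).prod

/-- `C_{g,d}(A,B) = ∑_{α,β ⊢ d} (-1)^{d+ℓ(α)+ℓ(β)} H⃗_g(α,β)
(N^{-ℓ(α)} p_α(A)) (N^{-ℓ(β)} p_β(B))`. -/
noncomputable def Cmat {N : ℕ} (g d : ℕ) (A B : Matrix (Fin N) (Fin N) ℂ) : ℂ :=
  ∑ α : d.Partition, ∑ β : d.Partition,
    (-1 : ℂ) ^ (d + α.parts.card + β.parts.card) * (Hg d g α β : ℂ) *
      (((N : ℂ) ^ α.parts.card)⁻¹ * pPoly A α) * (((N : ℂ) ^ β.parts.card)⁻¹ * pPoly B β)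

/-- `C_{g,d}(Φ,Ψ) = ∑_{α,β ⊢ d} (-1)^{d+ℓ(α)+ℓ(β)} H⃗_g(α,β) φ_α ψ_β`. -/
noncomputable def Cseq (g d : ℕ) (Φ Ψ : ℕ → ℂ) : ℂ :=
  ∑ α : d.Partition, ∑ β : d.Partition,
    (-1 : ℂ) ^ (d + α.parts.card + β.parts.card) * (Hg d g α β : ℂ) *
      momProd Φ α * momProd Ψ β

/-- The HCIZ integral `I_N(z;A,B)` with respect to a measure `μ` on `U(N)`. -/
noncomputable def hciz {N : ℕ} (μ : Measure (Matrix.unitaryGroup (Fin N) ℂ))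
    (A B : Matrix (Fin N) (Fin N) ℂ) (z : ℂ) : ℂ :=
  ∫ U : Matrix.unitaryGroup (Fin N) ℂ,
    Complex.exp (-(z * (N : ℂ) *
      (A * (U : Matrix (Fin N) (Fin N) ℂ) * B *
        ((U⁻¹ : Matrix.unitaryGroup (Fin N) ℂ) : Matrix (Fin N) (Fin N) ℂ)).trace)) ∂μ

/-- A free-energy branch for `I_N(·;A,B)` on the disc `D(0,ε)`: a holomorphic
function `F` with `F 0 = 0` and `exp (N² F z) = I_N(z;A,B)` on the disc. -/
def IsFreeEnergyBranch {N : ℕ} (μ : Measure (Matrix.unitaryGroup (Fin N) ℂ))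
    (A B : Matrix (Fin N) (Fin N) ℂ) (ε : ℝ) (F : ℂ → ℂ) : Prop :=
  DifferentiableOn ℂ F (Metric.ball 0 ε) ∧ F 0 = 0 ∧
    ∀ z ∈ Metric.ball (0 : ℂ) ε, Complex.exp ((N : ℂ) ^ 2 * F z) = hciz μ A B z

/-- The L² operator norm of a matrix. -/
noncomputable def opNorm {N : ℕ} (A : Matrix (Fin N) (Fin N) ℂ) : ℝ :=
  ‖Matrix.toEuclideanCLM (𝕜 := ℂ) A‖

/-- The all-ones partition `(1^d)`. -/
def onesPartition (d : ℕ) : d.Partition :=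
  ⟨Multiset.replicate d 1, fun {i} hi => by
    rw [Multiset.eq_of_mem_replicate hi]; exact one_pos, by simp⟩

/-- The partition `(2,1^{d-2})` of `d`, for `d ≥ 2`. -/
def twoOnesPartition (d : ℕ) (hd : 2 ≤ d) : d.Partition :=
  ⟨2 ::ₘ Multiset.replicate (d - 2) 1, fun {i} hi => by
    rcases Multiset.mem_cons.mp hi with h | h
    · omega
    · rw [Multiset.eq_of_mem_replicate h]; exact one_pos, by
    simp [Multiset.sum_cons]; omega⟩

section Compact

variable {X : Type*} [TopologicalSpace X] [CompactSpace X] [MeasurableSpace X]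
  [OpensMeasurableSpace X] {μ : Measure X} [IsFiniteMeasure μ]

theorem integrable_of_continuous_of_compactSpace {E : Type*} [NormedAddCommGroup E]
    {f : X → E} (hf : Continuous f) : Integrable f μ := by
  obtain ⟨C, hC⟩ := isCompact_univ.exists_bound_of_continuousOn hf.continuousOn
  exact Integrable.of_bound (hf.aestronglyMeasurable_of_compactSpace) C
    (Filter.Eventually.of_forall fun x => hC x (Set.mem_univ x))

/-- Differentiation under the integral sign over a compact space. -/
theorem hasDerivAt_integral_of_compactSpace {𝕜 : Type*} [RCLike 𝕜] {F F' : 𝕜 → X → 𝕜}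
    (hF : ∀ t, Continuous (F t)) (hF' : Continuous (Function.uncurry F'))
    (h : ∀ t x, HasDerivAt (F · x) (F' t x) t) (t : 𝕜) :
    HasDerivAt (fun s => ∫ x, F s x ∂μ) (∫ x, F' t x ∂μ) t := by
  obtain ⟨C, hC⟩ := ((isCompact_closedBall t 1).prod
    (isCompact_univ (X := X))).exists_bound_of_continuousOn hF'.continuousOn
  have hm : ∀ {f : X → 𝕜}, Continuous f → AEStronglyMeasurable f μ :=
    fun hf => (integrable_of_continuous_of_compactSpace hf).1
  exact (hasDerivAt_integral_of_dominated_loc_of_deriv_le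
    (Metric.closedBall_mem_nhds t one_pos) (Filter.Eventually.of_forall fun s => hm (hF s))
    (integrable_of_continuous_of_compactSpace (hF t))
    (hm (hF'.comp (by fun_prop : Continuous fun x : X => (t, x))))
    (Filter.Eventually.of_forall fun x s hs => hC (s, x) ⟨hs, Set.mem_univ x⟩)
    (integrable_const C) (Filter.Eventually.of_forall fun x s _ => h s x)).2

end Compact

section Unitary

variable {N : ℕ}

instance : CompactSpace (Matrix.unitaryGroup (Fin N) ℂ) := by
  refine isCompact_iff_compactSpace.mp ?_
  have h : IsCompact (Set.pi Set.univ fun _ : Fin N => Set.pi Set.univ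
      fun _ : Fin N => Metric.closedBall (0 : ℂ) 1) :=
    isCompact_univ_pi fun _ => isCompact_univ_pi fun _ => isCompact_closedBall _ _
  refine IsCompact.of_isClosed_subset (X := Matrix (Fin N) (Fin N) ℂ) h ?_ fun U hU => ?_
  · have : ((Matrix.unitaryGroup (Fin N) ℂ : Submonoid _) : Set (Matrix (Fin N) (Fin N) ℂ)) =
        {U | U * star U = 1} := by
      ext U; exact Matrix.mem_unitaryGroup_iff
    rw [this]
    exact isClosed_eq (by fun_prop) continuous_const
  · exact fun i _ j _ => mem_closedBall_zero_iff.mpr (entry_norm_bound_of_unitary hU i j)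

instance : BorelSpace (Matrix.unitaryGroup (Fin N) ℂ) :=
  inferInstanceAs (BorelSpace (Subtype _))

end Unitary

section Orbit

variable {N : ℕ}

/-- The point `U B U*` of the orbit of `B`. -/
def orbitPoint (B : Matrix (Fin N) (Fin N) ℂ) (U : Matrix.unitaryGroup (Fin N) ℂ) :
    Matrix (Fin N) (Fin N) ℂ :=
  (U : Matrix (Fin N) (Fin N) ℂ) * B * star (U : Matrix (Fin N) (Fin N) ℂ)

/-- The diagonal of `U B U*`. -/
def orbitDiag (B : Matrix (Fin N) (Fin N) ℂ) (U : Matrix.unitaryGroup (Fin N) ℂ) (i : Fin N) : ℝ :=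
  (orbitPoint B U i i).re

/-- The exponential weight `exp (∑ aᵢ yᵢ)` where `y` is the diagonal of `U B U*`. -/
noncomputable def orbitWeight (B : Matrix (Fin N) (Fin N) ℂ) (a : Fin N → ℝ)
    (U : Matrix.unitaryGroup (Fin N) ℂ) : ℝ :=
  Real.exp (∑ k, a k * orbitDiag B U k)

@[fun_prop]
theorem continuous_orbitPoint (B : Matrix (Fin N) (Fin N) ℂ) : Continuous (orbitPoint B) := by
  unfold orbitPoint; fun_prop

@[fun_prop]
theorem continuous_orbitDiag (B : Matrix (Fin N) (Fin N) ℂ) : Continuous (orbitDiag B) := by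
  unfold orbitDiag; fun_prop

@[fun_prop]
theorem continuous_orbitDiag_apply (B : Matrix (Fin N) (Fin N) ℂ) (i : Fin N) :
    Continuous fun U => orbitDiag B U i := by
  unfold orbitDiag; fun_prop

@[fun_prop]
theorem continuous_orbitWeight (B : Matrix (Fin N) (Fin N) ℂ) (a : Fin N → ℝ) :
    Continuous (orbitWeight B a) := by
  unfold orbitWeight; fun_prop

theorem orbitPoint_mul (B : Matrix (Fin N) (Fin N) ℂ) (V U : Matrix.unitaryGroup (Fin N) ℂ) :
    orbitPoint B (V * U) = V.1 * orbitPoint B U * star V.1 := by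
  simp [orbitPoint, Matrix.mul_assoc]

theorem orbitPoint_isHermitian {B : Matrix (Fin N) (Fin N) ℂ} (hB : B.IsHermitian)
    (U : Matrix.unitaryGroup (Fin N) ℂ) : (orbitPoint B U).IsHermitian :=
  Matrix.isHermitian_mul_mul_conjTranspose U.1 hB

theorem orbitPoint_swap {B : Matrix (Fin N) (Fin N) ℂ} (hB : B.IsHermitian)
    (U : Matrix.unitaryGroup (Fin N) ℂ) (i j : Fin N) :
    orbitPoint B U j i = star (orbitPoint B U i j) :=
  ((orbitPoint_isHermitian hB U).apply j i).symm

/-- The generator of rotations in the coordinate plane `(i, j)`. -/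
def rotGen (i j : Fin N) : Matrix (Fin N) (Fin N) ℂ :=
  Matrix.single i j 1 - Matrix.single j i 1

/-- The projection on the coordinate plane `(i, j)`. -/
def rotProj (i j : Fin N) : Matrix (Fin N) (Fin N) ℂ :=
  Matrix.single i i 1 + Matrix.single j j 1

/-- The rotation by the angle `θ` in the coordinate plane `(i, j)`. -/
noncomputable def rotMatrix (i j : Fin N) (θ : ℝ) : Matrix (Fin N) (Fin N) ℂ :=
  1 + ((Real.cos θ - 1 : ℝ) : ℂ) • rotProj i j + ((Real.sin θ : ℝ) : ℂ) • rotGen i j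

theorem star_rotMatrix (i j : Fin N) (θ : ℝ) : star (rotMatrix i j θ) =
    1 + ((Real.cos θ - 1 : ℝ) : ℂ) • rotProj i j - ((Real.sin θ : ℝ) : ℂ) • rotGen i j := by
  simp only [rotMatrix, rotProj, rotGen, star_add, star_one, star_smul, star_sub,
    Matrix.star_eq_conjTranspose, Matrix.conjTranspose_single, star_one]
  simp only [Complex.star_def, Complex.conj_ofReal]
  module

theorem rotMatrix_mem {i j : Fin N} (hij : i ≠ j) (θ : ℝ) :
    rotMatrix i j θ ∈ Matrix.unitaryGroup (Fin N) ℂ := by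
  rw [Matrix.mem_unitaryGroup_iff, star_rotMatrix, rotMatrix]
  have hPP : rotProj i j * rotProj i j = rotProj i j := by
    simp [rotProj, Matrix.add_mul, Matrix.mul_add, hij, hij.symm]
  have hPK : rotProj i j * rotGen i j = rotGen i j := by
    simp [rotProj, rotGen, Matrix.add_mul, Matrix.mul_sub, hij, hij.symm]
  have hKP : rotGen i j * rotProj i j = rotGen i j := by
    simp [rotProj, rotGen, Matrix.sub_mul, Matrix.mul_add, hij, hij.symm]
    abel
  have hKK : rotGen i j * rotGen i j = -rotProj i j := by
    simp [rotProj, rotGen, Matrix.sub_mul, Matrix.mul_sub, hij, hij.symm]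
    abel
  have hcs : ((Real.sin θ : ℝ) : ℂ) ^ 2 = 1 - ((Real.cos θ : ℝ) : ℂ) ^ 2 := by
    rw [← Complex.ofReal_pow, Real.sin_sq]; push_cast; ring
  simp only [add_mul, mul_sub, mul_add, one_mul, mul_one, smul_mul_smul_comm, hPP, hPK, hKP, hKK]
  rw [← sq ((Real.sin θ : ℝ) : ℂ), hcs]
  push_cast
  module

theorem hasDerivAt_rotMatrix (i j k l : Fin N) (θ : ℝ) :
    HasDerivAt (fun θ => rotMatrix i j θ k l)
      ((((-Real.sin θ : ℝ) : ℂ) • rotProj i j + ((Real.cos θ : ℝ) : ℂ) • rotGen i j) k l) θ := by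
  simp only [rotMatrix, Matrix.add_apply, Matrix.smul_apply, smul_eq_mul]
  have h1 := (((Real.hasDerivAt_cos θ).sub_const 1).ofReal_comp).mul_const (rotProj i j k l)
  have h2 := ((Real.hasDerivAt_sin θ).ofReal_comp).mul_const (rotGen i j k l)
  simpa [add_assoc] using (h1.add h2).const_add ((1 : Matrix (Fin N) (Fin N) ℂ) k l)

theorem hasDerivAt_rot_conj (Y : Matrix (Fin N) (Fin N) ℂ) (i j k l : Fin N) (θ : ℝ) :
    HasDerivAt (fun θ => (rotMatrix i j θ * Y * star (rotMatrix i j θ)) k l)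
      (((((-Real.sin θ : ℝ) : ℂ) • rotProj i j + ((Real.cos θ : ℝ) : ℂ) • rotGen i j) * Y *
        star (rotMatrix i j θ) + rotMatrix i j θ * Y *
        star (((-Real.sin θ : ℝ) : ℂ) • rotProj i j + ((Real.cos θ : ℝ) : ℂ) • rotGen i j)) k l)
      θ := by
  simp only [Matrix.mul_apply, Matrix.star_apply, Matrix.add_apply (_ * _)]
  rw [← Finset.sum_add_distrib]
  refine HasDerivAt.fun_sum fun p _ => ?_
  refine HasDerivAt.mul (HasDerivAt.fun_sum fun q _ => ?_) ?_
  · exact (hasDerivAt_rotMatrix i j k q θ).mul_const _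
  · exact (hasDerivAt_rotMatrix i j l p θ).star

theorem rotGen_commutator (Y : Matrix (Fin N) (Fin N) ℂ) (i j k l : Fin N) :
    (rotGen i j * Y + Y * star (rotGen i j)) k l =
      (if k = i then Y j l else 0) - (if k = j then Y i l else 0) +
      ((if l = i then Y k j else 0) - (if l = j then Y k i else 0)) := by
  simp only [rotGen, Matrix.star_eq_conjTranspose, Matrix.conjTranspose_sub,
    Matrix.conjTranspose_single, star_one, Matrix.sub_mul, Matrix.mul_sub, Matrix.add_apply,
    Matrix.sub_apply, Matrix.mul_apply, Matrix.single_apply]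
  simp [ite_and, eq_comm, Finset.sum_ite_eq]

variable {μ : Measure (Matrix.unitaryGroup (Fin N) ℂ)} [μ.IsMulLeftInvariant]

theorem integral_rot_identity [IsFiniteMeasure μ] {B : Matrix (Fin N) (Fin N) ℂ} (hB : B.IsHermitian) (a : Fin N → ℝ)
    {i j : Fin N} (hij : i ≠ j) :
    ∫ U, (2 * (orbitPoint B U i j).re ^ 2 * (a i - a j) - (orbitDiag B U i - orbitDiag B U j)) *
      orbitWeight B a U ∂μ = 0 := by
  set Y : ℝ → Matrix.unitaryGroup (Fin N) ℂ → Matrix (Fin N) (Fin N) ℂ := fun θ U =>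
    rotMatrix i j θ * orbitPoint B U * star (rotMatrix i j θ) with hY
  set R' : ℝ → Matrix (Fin N) (Fin N) ℂ := fun θ =>
    ((-Real.sin θ : ℝ) : ℂ) • rotProj i j + ((Real.cos θ : ℝ) : ℂ) • rotGen i j with hR'
  set Y' : ℝ → Matrix.unitaryGroup (Fin N) ℂ → Matrix (Fin N) (Fin N) ℂ := fun θ U =>
    R' θ * orbitPoint B U * star (rotMatrix i j θ) + rotMatrix i j θ * orbitPoint B U *
      star (R' θ) with hY'
  have hd : ∀ θ U k l, HasDerivAt (fun θ => (Y θ U k l).re) (Y' θ U k l).re θ := fun θ U k l =>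
    Complex.reCLM.hasFDerivAt.comp_hasDerivAt θ (hasDerivAt_rot_conj (orbitPoint B U) i j k l θ)
  have hRc : Continuous (rotMatrix i j) := by unfold rotMatrix; fun_prop
  have hR'c : Continuous R' := by rw [hR']; fun_prop
  have hYc : Continuous fun p : ℝ × Matrix.unitaryGroup (Fin N) ℂ => Y p.1 p.2 := by
    rw [hY]; fun_prop
  have hY'c : Continuous fun p : ℝ × Matrix.unitaryGroup (Fin N) ℂ => Y' p.1 p.2 := by
    rw [hY']; fun_prop
  have hYe : ∀ k l, Continuous fun p : ℝ × Matrix.unitaryGroup (Fin N) ℂ => (Y p.1 p.2 k l).re :=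
    fun k l => by fun_prop
  have hY'e : ∀ k l, Continuous fun p : ℝ × Matrix.unitaryGroup (Fin N) ℂ => (Y' p.1 p.2 k l).re :=
    fun k l => by fun_prop
  have key := hasDerivAt_integral_of_compactSpace (μ := μ)
    (F := fun θ U => (Y θ U i j).re * Real.exp (∑ k, a k * (Y θ U k k).re))
    (F' := fun θ U => (Y' θ U i j).re * Real.exp (∑ k, a k * (Y θ U k k).re) + (Y θ U i j).re *
      (Real.exp (∑ k, a k * (Y θ U k k).re) * ∑ k, a k * (Y' θ U k k).re))
    (fun θ => by
      have := fun k l => (hYe k l).comp (by fun_prop :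
        Continuous fun U : Matrix.unitaryGroup (Fin N) ℂ => (θ, U))
      simp only [Function.comp_def] at this
      fun_prop)
    (by simp only [Function.uncurry_def]; fun_prop)
    (fun θ U => (hd θ U i j).mul (HasDerivAt.fun_sum fun k _ => (hd θ U k k).const_mul (a k)).exp)
    0
  have hconst : ∀ θ, ∫ U, (Y θ U i j).re * Real.exp (∑ k, a k * (Y θ U k k).re) ∂μ =
      ∫ U, (orbitPoint B U i j).re * orbitWeight B a U ∂μ := fun θ => by
    rw [← integral_mul_left_eq_self (fun U => (orbitPoint B U i j).re * orbitWeight B a U)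
      ⟨rotMatrix i j θ, rotMatrix_mem hij θ⟩]
    simp only [orbitWeight, orbitDiag, orbitPoint_mul, hY]
  rw [funext hconst] at key
  refine Eq.trans ?_ ((hasDerivAt_const (0 : ℝ) _).unique key).symm
  congr 1
  ext U
  have h0 : Y 0 U = orbitPoint B U := by simp [hY, rotMatrix]
  have h1 : Y' 0 U = rotGen i j * orbitPoint B U + orbitPoint B U * star (rotGen i j) := by
    simp [hY', hR', rotMatrix]
  have h2 : ∀ k, (Y' 0 U k k).re = (if k = i then 2 * (orbitPoint B U i j).re else 0) -
      (if k = j then 2 * (orbitPoint B U i j).re else 0) := by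
    intro k
    rw [h1, rotGen_commutator]
    have := congrArg Complex.re (orbitPoint_swap hB U i j)
    simp only [Complex.star_def, Complex.conj_re] at this
    split_ifs <;> subst_vars <;> simp [this] <;> ring
  have h3 : (Y' 0 U i j).re = orbitDiag B U j - orbitDiag B U i := by
    rw [h1, rotGen_commutator]
    simp [hij, hij.symm, orbitDiag]; ring
  simp only [h0, h3, h2, mul_sub, mul_ite, mul_zero, Finset.sum_sub_distrib, Finset.sum_ite_eq',
    Finset.mem_univ, if_true]
  simp only [orbitWeight, orbitDiag]
  ring

theorem integral_phase_identity (B : Matrix (Fin N) (Fin N) ℂ) (a : Fin N → ℝ)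
    {i j : Fin N} (hij : i ≠ j) :
    ∫ U, (orbitPoint B U i j).re ^ 2 * orbitWeight B a U ∂μ =
      ∫ U, (orbitPoint B U i j).im ^ 2 * orbitWeight B a U ∂μ := by
  set d : Fin N → ℂ := fun k => if k = i then Complex.I else 1 with hd
  have hdd : ∀ k, d k * star (d k) = 1 := fun k => by
    simp only [hd]; split_ifs <;> simp
  have hmem : Matrix.diagonal d ∈ Matrix.unitaryGroup (Fin N) ℂ := by
    rw [Matrix.mem_unitaryGroup_iff, Matrix.star_eq_conjTranspose, Matrix.diagonal_conjTranspose,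
      Matrix.diagonal_mul_diagonal, ← Matrix.diagonal_one]
    congr 1; ext k; exact hdd k
  have hent : ∀ U k l, orbitPoint B (⟨Matrix.diagonal d, hmem⟩ * U) k l =
      d k * orbitPoint B U k l * star (d l) := fun U k l => by
    rw [orbitPoint_mul, Matrix.star_eq_conjTranspose, Matrix.diagonal_conjTranspose,
      Matrix.mul_diagonal, Matrix.diagonal_mul]
    rfl
  rw [← integral_mul_left_eq_self _ ⟨Matrix.diagonal d, hmem⟩]
  congr 1
  ext U
  have h1 : ∀ k, orbitDiag B (⟨Matrix.diagonal d, hmem⟩ * U) k = orbitDiag B U k := fun k => by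
    rw [orbitDiag, hent, mul_right_comm, hdd, one_mul, orbitDiag]
  simp only [orbitWeight, h1, hent]
  simp [hd, hij.symm]

theorem integral_orbit_identity [IsFiniteMeasure μ] {B : Matrix (Fin N) (Fin N) ℂ} (hB : B.IsHermitian)
    (a : Fin N → ℝ) {i j : Fin N} (hij : i ≠ j) :
    ∫ U, (Complex.normSq (orbitPoint B U i j) * (a i - a j) -
      (orbitDiag B U i - orbitDiag B U j)) * orbitWeight B a U ∂μ = 0 := by
  have hint : ∀ {f : Matrix.unitaryGroup (Fin N) ℂ → ℝ}, Continuous f → Integrable f μ :=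
    fun hf => integrable_of_continuous_of_compactSpace hf
  have e1 := integral_rot_identity (μ := μ) hB a hij
  have e2 := integral_phase_identity (μ := μ) B a hij
  have h : ∀ U, (Complex.normSq (orbitPoint B U i j) * (a i - a j) -
      (orbitDiag B U i - orbitDiag B U j)) * orbitWeight B a U =
      (2 * (orbitPoint B U i j).re ^ 2 * (a i - a j) - (orbitDiag B U i - orbitDiag B U j)) *
      orbitWeight B a U + (a i - a j) * ((orbitPoint B U i j).im ^ 2 * orbitWeight B a U -
        (orbitPoint B U i j).re ^ 2 * orbitWeight B a U) := fun U => by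
    rw [Complex.normSq_apply]; ring
  simp only [h]
  rw [integral_add (hint (by fun_prop)) (hint (by fun_prop)), e1, integral_const_mul,
    integral_sub (hint (by fun_prop)) (hint (by fun_prop)), e2]
  simp

end Orbit

section Gaussian

open ProbabilityTheory Polynomial
open scoped NNReal

theorem integral_mul_exp_gaussianReal (f : ℝ → ℝ) (a y : ℝ) (v : ℝ≥0) :
    ∫ x, f x * Real.exp (x * y) ∂gaussianReal a v =
      Real.exp (a * y + v * y ^ 2 / 2) * ∫ x, f x ∂gaussianReal (a + v * y) v := by
  rcases eq_or_ne v 0 with rfl | hv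
  · simp [mul_comm]
  · rw [integral_gaussianReal_eq_integral_smul hv, integral_gaussianReal_eq_integral_smul hv,
      ← integral_const_mul]
    congr 1
    ext x
    have hv' : (v : ℝ) ≠ 0 := by exact_mod_cast hv
    simp only [gaussianPDFReal, smul_eq_mul]
    have h : Real.exp (-(x - a) ^ 2 / (2 * v)) * Real.exp (x * y) =
        Real.exp (a * y + v * y ^ 2 / 2) * Real.exp (-(x - (a + v * y)) ^ 2 / (2 * v)) := by
      rw [← Real.exp_add, ← Real.exp_add]
      congr 1
      field_simp
      ring
    linear_combination (√(2 * Real.pi * v))⁻¹ * f x * h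

theorem integrable_pow_mul_exp_gaussianReal (k : ℕ) (a t : ℝ) (v : ℝ≥0) :
    Integrable (fun x => x ^ k * Real.exp (t * x)) (gaussianReal a v) :=
  integrable_pow_mul_exp_of_mem_interior_integrableExpSet (X := id)
    (by simp [integrableExpSet_id_gaussianReal]) k

theorem integrable_pow_gaussianReal (k : ℕ) (a : ℝ) (v : ℝ≥0) :
    Integrable (fun x => x ^ k) (gaussianReal a v) := by
  simpa using integrable_pow_mul_exp_gaussianReal k a 0 v

/-- The polynomial `s ↦ E[c ^ k]`, where `c` is Gaussian with mean `s` and variance `v`. -/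
noncomputable def momentPoly (v : ℝ≥0) (k : ℕ) : ℝ[X] :=
  ∑ i ∈ Finset.range (k + 1), C ((k.choose i : ℝ) * ∫ x, x ^ (k - i) ∂gaussianReal 0 v) * X ^ i

theorem eval_momentPoly (v : ℝ≥0) (k : ℕ) (s : ℝ) :
    (momentPoly v k).eval s = ∫ x, x ^ k ∂gaussianReal s v := by
  have h : gaussianReal s v = (gaussianReal 0 v).map (s + ·) := by
    rw [gaussianReal_map_const_add, zero_add]
  rw [h, integral_map (by fun_prop) (by fun_prop)]
  simp only [add_pow]
  rw [integral_finsetSum _ fun i _ => ?_, momentPoly, eval_finsetSum]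
  · refine Finset.sum_congr rfl fun i _ => ?_
    rw [integral_mul_const, integral_const_mul]
    simp
    ring
  · exact ((integrable_pow_gaussianReal _ _ _).const_mul _).mul_const _

theorem derivative_momentPoly (v : ℝ≥0) (k : ℕ) :
    derivative (momentPoly v (k + 1)) = C ((k : ℝ) + 1) * momentPoly v k := by
  rw [momentPoly, Finset.sum_range_succ', momentPoly]
  simp only [derivative_add, derivative_sum, Finset.mul_sum]
  simp only [pow_zero, mul_one, derivative_C, add_zero]
  refine Finset.sum_congr rfl fun i _ => ?_
  have h : ((k + 1).choose (i + 1) : ℝ) * (i + 1) = (k + 1) * (k.choose i) := by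
    exact_mod_cast (Nat.add_one_mul_choose_eq k i).symm
  rw [derivative_C_mul_X_pow, ← mul_assoc, ← C_mul]
  congr 2
  rw [Nat.add_sub_add_right]
  push_cast
  linear_combination (∫ x, x ^ (k - i) ∂gaussianReal 0 v) * h

theorem hasDerivAt_momentPoly (v : ℝ≥0) (k : ℕ) (s : ℝ) :
    HasDerivAt (fun s => (momentPoly v k).eval s)
      (∫ x, k * x ^ (k - 1) ∂gaussianReal s v) s := by
  have h := (momentPoly v k).hasDerivAt s
  rcases k with _ | k
  · simpa [momentPoly] using h
  · rw [derivative_momentPoly, eval_mul, eval_C, eval_momentPoly] at h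
    simpa [integral_const_mul] using h

theorem momentPoly_coeff_self (v : ℝ≥0) (k : ℕ) : (momentPoly v k).coeff k = 1 := by
  rw [momentPoly, finsetSum_coeff]
  simp only [coeff_C_mul_X_pow]
  simp

theorem momentPoly_natDegree (v : ℝ≥0) (k : ℕ) : (momentPoly v k).natDegree = k := by
  refine le_antisymm ?_ (le_natDegree_of_ne_zero (by simp [momentPoly_coeff_self]))
  refine natDegree_sum_le_of_forall_le _ _ fun i hi => ?_
  exact (natDegree_C_mul_X_pow_le _ _).trans (Finset.mem_range_succ_iff.mp hi)

theorem momentPoly_monic (v : ℝ≥0) (k : ℕ) : (momentPoly v k).Monic := by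
  rw [Monic, leadingCoeff, momentPoly_natDegree, momentPoly_coeff_self]

end Gaussian

section VandermondeProduct

open ProbabilityTheory
open scoped NNReal

variable {N : ℕ}

/-- The pairs `(i, j)` with `i < j`. -/
def pairs (N : ℕ) : Finset (Fin N × Fin N) := Finset.univ.filter fun p => p.1 < p.2

/-- The Vandermonde product `∏_{i < j} (cⱼ - cᵢ)`. -/
def vdm (c : Fin N → ℝ) : ℝ := ∏ p ∈ pairs N, (c p.2 - c p.1)

/-- The derivative of `vdm` at `c` in the direction `y`. -/
def vdmDir (c y : Fin N → ℝ) : ℝ :=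
  ∑ p ∈ pairs N, (∏ q ∈ (pairs N).erase p, (c q.2 - c q.1)) * (y p.2 - y p.1)

theorem vdm_eq_det (c : Fin N → ℝ) : vdm c = (vandermonde c).det := by
  rw [det_vandermonde, vdm, pairs, Finset.prod_filter, Fintype.prod_prod_type]
  refine Finset.prod_congr rfl fun i _ => ?_
  rw [← Finset.prod_filter]
  refine Finset.prod_congr ?_ fun _ _ => rfl
  ext j; simp

theorem hasDerivAt_vdm {c : ℝ → Fin N → ℝ} {y : Fin N → ℝ} {t : ℝ}
    (h : ∀ i, HasDerivAt (fun t => c t i) (y i) t) :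
    HasDerivAt (fun t => vdm (c t)) (vdmDir (c t) y) t := by
  simpa [vdm, vdmDir] using HasDerivAt.fun_finsetProd (u := pairs N)
    (f := fun p t => c t p.2 - c t p.1) (f' := fun p => y p.2 - y p.1) (x := t)
    fun p _ => (h p.2).sub (h p.1)

theorem vdmDir_eq_sum (c y : Fin N → ℝ) :
    vdmDir c y = ∑ i, y i * vdmDir c (Pi.single i 1) := by
  simp only [vdmDir, Finset.mul_sum]
  rw [Finset.sum_comm]
  refine Finset.sum_congr rfl fun p _ => ?_
  simp [Pi.single_apply, mul_sub, Finset.sum_sub_distrib]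
  ring

theorem det_updateRow_deriv {g g' : Fin N → ℝ → ℝ}
    (hg : ∀ c : Fin N → ℝ, (Matrix.of fun i j => g j (c i)).det = vdm c)
    (hd : ∀ j t, HasDerivAt (g j) (g' j t) t) (c : Fin N → ℝ) (i : Fin N) :
    ((Matrix.of fun i j => g j (c i)).updateRow i fun j => g' j (c i)).det =
      vdmDir c (Pi.single i 1) := by
  have h1 : HasDerivAt (fun t => vdm (Function.update c i t))
      (vdmDir (Function.update c i (c i)) (Pi.single i 1)) (c i) := by
    refine hasDerivAt_vdm fun k => ?_
    rcases eq_or_ne k i with rfl | hk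
    · simpa using hasDerivAt_id' (c k)
    · simpa [hk] using hasDerivAt_const (c i) (c k)
  have h2 : ∀ t, vdm (Function.update c i t) =
      ((Matrix.of fun i j => g j (c i)).updateRow i fun j => g j t).det := fun t => by
    rw [← hg]
    congr 1
    ext k l
    rcases eq_or_ne k i with rfl | hk
    · simp
    · simp [hk]
  have h3 : ∀ u : Fin N → ℝ, ((Matrix.of fun i j => g j (c i)).updateRow i u).det =
      ∑ j, u j * (Matrix.of fun i j => g j (c i)).adjugate j i := fun u => by
    rw [det_eq_sum_mul_adjugate_row _ i]
    refine Finset.sum_congr rfl fun j _ => ?_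
    rw [updateRow_self, adjugate_apply, adjugate_apply, updateRow_idem]
  simp only [h2, h3] at h1
  rw [h3]
  have h4 := HasDerivAt.fun_sum (u := Finset.univ) (x := c i)
    (A := fun j t => g j t * (Matrix.of fun i j => g j (c i)).adjugate j i)
    (A' := fun j => g' j (c i) * (Matrix.of fun i j => g j (c i)).adjugate j i)
    fun j _ => (hd j (c i)).mul_const _
  rw [h4.unique h1, Function.update_eq_self]

theorem integrable_det_pi {f : Fin N → Fin N → ℝ → ℝ} {ν : Fin N → Measure ℝ}
    [∀ i, SigmaFinite (ν i)] (hf : ∀ i j, Integrable (f i j) (ν i)) :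
    Integrable (fun c => (Matrix.of fun i j => f i j (c i)).det) (Measure.pi ν) := by
  conv => enter [1, c]; rw [← det_transpose]
  simp only [det_apply', transpose_apply, of_apply]
  exact integrable_finsetSum _ fun σ _ =>
    (Integrable.fintype_prod fun i => hf i (σ i)).const_mul _

theorem integral_det_pi {f : Fin N → Fin N → ℝ → ℝ} {ν : Fin N → Measure ℝ}
    [∀ i, SigmaFinite (ν i)] (hf : ∀ i j, Integrable (f i j) (ν i)) :
    ∫ c, (Matrix.of fun i j => f i j (c i)).det ∂Measure.pi ν =
      (Matrix.of fun i j => ∫ x, f i j x ∂ν i).det := by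
  rw [← det_transpose]
  conv_lhs => enter [2, c]; rw [← det_transpose]
  simp only [det_apply', transpose_apply, of_apply]
  rw [integral_finsetSum]
  · refine Finset.sum_congr rfl fun σ _ => ?_
    rw [integral_const_mul, integral_fintype_prod_eq_prod (fun i => f i (σ i))]
  · exact fun σ _ => (Integrable.fintype_prod fun i => hf i (σ i)).const_mul _

theorem det_mul_exp_eq (f : Fin N → Fin N → ℝ → ℝ) (y c : Fin N → ℝ) :
    (Matrix.of fun i j => f i j (c i)).det * Real.exp (∑ i, c i * y i) =
      (Matrix.of fun i j => f i j (c i) * Real.exp (c i * y i)).det := by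
  rw [Real.exp_sum, mul_comm, ← det_mul_column]
  simp only [of_apply, mul_comm]

theorem integrable_det_mul_exp_gaussian {f : Fin N → Fin N → ℝ → ℝ} (a y : Fin N → ℝ) (v : ℝ≥0)
    (hf : ∀ i j, Integrable (fun x => f i j x * Real.exp (x * y i)) (gaussianReal (a i) v)) :
    Integrable (fun c => (Matrix.of fun i j => f i j (c i)).det * Real.exp (∑ i, c i * y i))
      (Measure.pi fun i => gaussianReal (a i) v) := by
  simp only [det_mul_exp_eq]
  exact integrable_det_pi (f := fun i j x => f i j x * Real.exp (x * y i)) hf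

theorem integral_det_mul_exp_gaussian {f : Fin N → Fin N → ℝ → ℝ} (a y : Fin N → ℝ) (v : ℝ≥0)
    (hf : ∀ i j, Integrable (fun x => f i j x * Real.exp (x * y i)) (gaussianReal (a i) v)) :
    ∫ c, (Matrix.of fun i j => f i j (c i)).det * Real.exp (∑ i, c i * y i)
        ∂Measure.pi (fun i => gaussianReal (a i) v) =
      Real.exp (∑ i, (a i * y i + v * y i ^ 2 / 2)) *
        (Matrix.of fun i j => ∫ x, f i j x ∂gaussianReal (a i + v * y i) v).det := by
  simp only [det_mul_exp_eq]
  rw [integral_det_pi (f := fun i j x => f i j x * Real.exp (x * y i)) hf, Real.exp_sum,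
    ← det_mul_column]
  simp only [integral_mul_exp_gaussianReal, of_apply]

theorem integral_vdm_gaussian (a y : Fin N → ℝ) (v : ℝ≥0) :
    Integrable (fun c => vdm c * Real.exp (∑ i, c i * y i))
      (Measure.pi fun i => gaussianReal (a i) v) ∧
    ∫ c, vdm c * Real.exp (∑ i, c i * y i) ∂Measure.pi (fun i => gaussianReal (a i) v) =
      Real.exp (∑ i, (a i * y i + v * y i ^ 2 / 2)) * vdm fun i => a i + v * y i := by
  have hint : ∀ i (j : Fin N), Integrable (fun x => x ^ (j : ℕ) * Real.exp (x * y i))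
      (gaussianReal (a i) v) := fun i j => by
    simpa [mul_comm] using integrable_pow_mul_exp_gaussianReal j (a i) (y i) v
  simp only [vdm_eq_det]
  refine ⟨integrable_det_mul_exp_gaussian (f := fun _ j x => x ^ (j : ℕ)) a y v hint,
    (integral_det_mul_exp_gaussian (f := fun _ j x => x ^ (j : ℕ)) a y v hint).trans ?_⟩
  rw [det_eval_matrixOfPolynomials_eq_det_vandermonde _ (fun j : Fin N => momentPoly v j)
    (fun j => momentPoly_natDegree v j) (fun j => momentPoly_monic v j)]
  simp only [eval_momentPoly]

theorem integral_vdmDir_single_gaussian (a y : Fin N → ℝ) (v : ℝ≥0) (i : Fin N) :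
    Integrable (fun c => vdmDir c (Pi.single i 1) * Real.exp (∑ i, c i * y i))
      (Measure.pi fun i => gaussianReal (a i) v) ∧
    ∫ c, vdmDir c (Pi.single i 1) * Real.exp (∑ i, c i * y i)
        ∂Measure.pi (fun i => gaussianReal (a i) v) =
      Real.exp (∑ i, (a i * y i + v * y i ^ 2 / 2)) *
        vdmDir (fun i => a i + v * y i) (Pi.single i 1) := by
  set f : Fin N → Fin N → ℝ → ℝ := fun k j x =>
    if k = i then (j : ℕ) * x ^ ((j : ℕ) - 1) else x ^ (j : ℕ) with hf
  have hint : ∀ k j, Integrable (fun x => f k j x * Real.exp (x * y k))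
      (gaussianReal (a k) v) := fun k j => by
    simp only [hf]
    split_ifs
    · have := (integrable_pow_mul_exp_gaussianReal ((j : ℕ) - 1) (a k) (y k) v).const_mul (j : ℕ)
      simpa only [mul_comm (y k), mul_assoc] using this
    · simpa only [mul_comm (y k)] using integrable_pow_mul_exp_gaussianReal j (a k) (y k) v
  have h1 : ∀ c : Fin N → ℝ, vdmDir c (Pi.single i 1) =
      (Matrix.of fun k j => f k j (c k)).det := fun c => by
    rw [← det_updateRow_deriv (g := fun j x => x ^ (j : ℕ))
      (g' := fun j x => (j : ℕ) * x ^ ((j : ℕ) - 1)) (fun c => (vdm_eq_det c).symm)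
      (fun j t => hasDerivAt_pow j t)]
    congr 1
    ext k j
    simp only [hf, updateRow_apply, of_apply]
    split_ifs with hk
    · rw [hk]
    · rfl
  have h2 : (Matrix.of fun k j => ∫ x, f k j x ∂gaussianReal (a k + v * y k) v).det =
      vdmDir (fun i => a i + v * y i) (Pi.single i 1) := by
    rw [← det_updateRow_deriv (g := fun j x => (momentPoly v j).eval x)
      (g' := fun j s => ∫ x, (j : ℕ) * x ^ ((j : ℕ) - 1) ∂gaussianReal s v) (fun c => by
        rw [vdm_eq_det, det_eval_matrixOfPolynomials_eq_det_vandermonde _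
          (fun j : Fin N => momentPoly v j)
          (fun j => momentPoly_natDegree v j) (fun j => momentPoly_monic v j)])
      (fun j t => hasDerivAt_momentPoly v j t)]
    congr 1
    ext k j
    simp only [hf, updateRow_apply, of_apply]
    split_ifs with hk
    · rw [hk]
    · rw [eval_momentPoly]
  simp only [h1]
  exact ⟨integrable_det_mul_exp_gaussian a y v hint,
    (integral_det_mul_exp_gaussian a y v hint).trans (by rw [h2, h1])⟩

theorem integral_vdmDir_gaussian (a y w : Fin N → ℝ) (v : ℝ≥0) :
    Integrable (fun c => vdmDir c w * Real.exp (∑ i, c i * y i))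
      (Measure.pi fun i => gaussianReal (a i) v) ∧
    ∫ c, vdmDir c w * Real.exp (∑ i, c i * y i) ∂Measure.pi (fun i => gaussianReal (a i) v) =
      Real.exp (∑ i, (a i * y i + v * y i ^ 2 / 2)) * vdmDir (fun i => a i + v * y i) w := by
  have h := fun i => integral_vdmDir_single_gaussian a y v i
  simp only [fun c => vdmDir_eq_sum c w, Finset.sum_mul, mul_assoc, Finset.mul_sum]
  refine ⟨integrable_finsetSum _ fun i _ => (h i).1.const_mul _, ?_⟩
  rw [integral_finsetSum _ fun i _ => (h i).1.const_mul _]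
  refine Finset.sum_congr rfl fun i _ => ?_
  rw [integral_const_mul, (h i).2]
  ring

end VandermondeProduct

section GaussianTransform

open ProbabilityTheory
open scoped NNReal

variable {N : ℕ}

@[fun_prop]
theorem continuous_vdm : Continuous (vdm (N := N)) := by
  unfold vdm; fun_prop

@[fun_prop]
theorem Continuous.vdmDir_comp {X : Type*} [TopologicalSpace X] {c y : X → Fin N → ℝ}
    (hc : Continuous c) (hy : Continuous y) : Continuous fun x => vdmDir (c x) (y x) := by
  unfold vdmDir; fun_prop

/-- The squared Hilbert–Schmidt norm of the off-diagonal part of `U B U*`. -/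
noncomputable def offSq (B : Matrix (Fin N) (Fin N) ℂ) (U : Matrix.unitaryGroup (Fin N) ℂ) : ℝ :=
  2 * ∑ p ∈ pairs N, Complex.normSq (orbitPoint B U p.1 p.2)

@[fun_prop]
theorem continuous_offSq (B : Matrix (Fin N) (Fin N) ℂ) : Continuous (offSq B) := by
  have : Continuous Complex.normSq := Complex.continuous_normSq
  unfold offSq; fun_prop

theorem offSq_nonneg (B : Matrix (Fin N) (Fin N) ℂ) (U : Matrix.unitaryGroup (Fin N) ℂ) :
    0 ≤ offSq B U :=
  mul_nonneg zero_le_two (Finset.sum_nonneg fun _ _ => Complex.normSq_nonneg _)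

theorem sum_diag_add_pairs (f : Fin N → Fin N → ℝ) (hf : ∀ i j, f i j = f j i) :
    ∑ i, f i i + 2 * ∑ p ∈ pairs N, f p.1 p.2 = ∑ i, ∑ j, f i j := by
  have h1 : ∑ p ∈ pairs N, f p.1 p.2 = ∑ i, ∑ j, if i < j then f i j else 0 := by
    rw [pairs, Finset.sum_filter, Fintype.sum_prod_type]
  have h2 : ∑ p ∈ pairs N, f p.1 p.2 = ∑ i, ∑ j, if j < i then f i j else 0 := by
    rw [h1, Finset.sum_comm]
    exact Finset.sum_congr rfl fun i _ => Finset.sum_congr rfl fun j _ => by rw [hf]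
  have h3 : ∑ i, f i i = ∑ i, ∑ j, if i = j then f i j else 0 := by simp
  rw [two_mul]
  nth_rw 1 [h1]
  rw [h2, h3, ← Finset.sum_add_distrib, ← Finset.sum_add_distrib]
  refine Finset.sum_congr rfl fun i _ => ?_
  rw [← Finset.sum_add_distrib, ← Finset.sum_add_distrib]
  refine Finset.sum_congr rfl fun j _ => ?_
  rcases lt_trichotomy i j with h | h | h
  · simp [h, h.ne, h.not_gt]
  · simp [h]
  · simp [h, h.ne', h.not_gt]

theorem sum_sq_orbitDiag_add_offSq {B : Matrix (Fin N) (Fin N) ℂ} (hB : B.IsHermitian)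
    (U : Matrix.unitaryGroup (Fin N) ℂ) :
    ∑ i, orbitDiag B U i ^ 2 + offSq B U = ((B * B).trace).re := by
  have h1 : ∀ i, orbitDiag B U i ^ 2 = Complex.normSq (orbitPoint B U i i) := fun i => by
    have h := (orbitPoint_isHermitian hB U).coe_re_apply_self i
    rw [orbitDiag, Complex.normSq_apply]
    have h2 : (orbitPoint B U i i).im = 0 := by
      rw [← h]; simp
    rw [h2]; ring
  have h2 : (orbitPoint B U * orbitPoint B U).trace = (B * B).trace := by
    have : star U.1 * U.1 = 1 := Matrix.mem_unitaryGroup_iff'.mp U.2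
    have h : orbitPoint B U * orbitPoint B U = U.1 * (B * B * star U.1) := by
      simp only [orbitPoint, Matrix.mul_assoc]
      rw [← Matrix.mul_assoc (star U.1) U.1, this, Matrix.one_mul]
    rw [h, Matrix.trace_mul_comm, Matrix.mul_assoc, this, Matrix.mul_one]
  have h3 : ((orbitPoint B U * orbitPoint B U).trace).re =
      ∑ i, ∑ j, Complex.normSq (orbitPoint B U i j) := by
    simp only [Matrix.trace, Matrix.diag, Matrix.mul_apply, Complex.re_sum]
    refine Finset.sum_congr rfl fun i _ => Finset.sum_congr rfl fun j _ => ?_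
    rw [orbitPoint_swap hB U i j, Complex.star_def, Complex.mul_conj, Complex.ofReal_re]
  simp only [h1]
  rw [← h2, h3, offSq]
  refine sum_diag_add_pairs (fun i j => Complex.normSq (orbitPoint B U i j)) fun i j => ?_
  rw [orbitPoint_swap hB U j i, Complex.star_def, Complex.normSq_conj]

section Integral

variable {μ : Measure (Matrix.unitaryGroup (Fin N) ℂ)} [IsFiniteMeasure μ]

theorem integral_vdm_identity [μ.IsMulLeftInvariant] {B : Matrix (Fin N) (Fin N) ℂ}
    (hB : B.IsHermitian) (c : Fin N → ℝ) :
    ∫ U, (2 * vdmDir c (orbitDiag B U) - offSq B U * vdm c) * orbitWeight B c U ∂μ = 0 := by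
  have h : ∀ U, (2 * vdmDir c (orbitDiag B U) - offSq B U * vdm c) * orbitWeight B c U =
      ∑ p ∈ pairs N, (2 * ∏ q ∈ (pairs N).erase p, (c q.2 - c q.1)) *
        ((Complex.normSq (orbitPoint B U p.1 p.2) * (c p.1 - c p.2) -
        (orbitDiag B U p.1 - orbitDiag B U p.2)) * orbitWeight B c U) := fun U => by
    rw [vdmDir, offSq, Finset.mul_sum, Finset.mul_sum, Finset.sum_mul, ← Finset.sum_sub_distrib,
      Finset.sum_mul]
    refine Finset.sum_congr rfl fun p hp => ?_
    rw [vdm, ← Finset.mul_prod_erase _ _ hp]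
    ring
  have hn : Continuous Complex.normSq := Complex.continuous_normSq
  simp only [h]
  rw [integral_finsetSum _ fun p _ =>
    integrable_of_continuous_of_compactSpace (by fun_prop)]
  refine Finset.sum_eq_zero fun p hp => ?_
  rw [integral_const_mul, integral_orbit_identity hB c (Finset.mem_filter.mp hp).2.ne, mul_zero]

/-- Functions of at most exponential growth in the first variable. -/
def ExpBounded {X : Type*} (f : (Fin N → ℝ) × X → ℝ) : Prop :=
  ∃ C K : ℝ, 0 ≤ C ∧ 0 ≤ K ∧ ∀ p, |f p| ≤ C * Real.exp (K * ∑ i, |p.1 i|)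

namespace ExpBounded

variable {X : Type*}

theorem of_continuous [TopologicalSpace X] [CompactSpace X] {f : X → ℝ} (hf : Continuous f) :
    ExpBounded (N := N) fun p : (Fin N → ℝ) × X => f p.2 := by
  obtain ⟨C, hC⟩ := isCompact_univ.exists_bound_of_continuousOn hf.continuousOn
  exact ⟨max C 0, 0, le_max_right _ _, le_rfl, fun p => by
    simpa using Or.inl (hC p.2 (Set.mem_univ _))⟩

theorem fst_apply (i : Fin N) : ExpBounded fun p : (Fin N → ℝ) × X => p.1 i :=
  ⟨1, 1, zero_le_one, zero_le_one, fun p => by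
    have h1 : |p.1 i| ≤ ∑ i, |p.1 i| :=
      Finset.single_le_sum (f := fun i => |p.1 i|) (fun _ _ => abs_nonneg _) (Finset.mem_univ i)
    have h2 := Real.add_one_le_exp (∑ i, |p.1 i|)
    simp only [one_mul]
    linarith⟩

theorem mul {f g : (Fin N → ℝ) × X → ℝ} (hf : ExpBounded f) (hg : ExpBounded g) :
    ExpBounded fun p => f p * g p := by
  obtain ⟨C, K, hC, hK, h⟩ := hf
  obtain ⟨C', K', hC', hK', h'⟩ := hg
  refine ⟨C * C', K + K', by positivity, by positivity, fun p => ?_⟩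
  rw [abs_mul, add_mul, Real.exp_add]
  calc _ ≤ (C * Real.exp (K * ∑ i, |p.1 i|)) * (C' * Real.exp (K' * ∑ i, |p.1 i|)) :=
        mul_le_mul (h p) (h' p) (abs_nonneg _) (by positivity)
    _ = _ := by ring

theorem add {f g : (Fin N → ℝ) × X → ℝ} (hf : ExpBounded f) (hg : ExpBounded g) :
    ExpBounded fun p => f p + g p := by
  obtain ⟨C, K, hC, hK, h⟩ := hf
  obtain ⟨C', K', hC', hK', h'⟩ := hg
  refine ⟨C + C', K + K', by positivity, by positivity, fun p => ?_⟩
  have hs : 0 ≤ ∑ i, |p.1 i| := Finset.sum_nonneg fun _ _ => abs_nonneg _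
  have h1 : Real.exp (K * ∑ i, |p.1 i|) ≤ Real.exp ((K + K') * ∑ i, |p.1 i|) := by
    gcongr; linarith
  have h2 : Real.exp (K' * ∑ i, |p.1 i|) ≤ Real.exp ((K + K') * ∑ i, |p.1 i|) := by
    gcongr; linarith
  calc _ ≤ |f p| + |g p| := abs_add_le _ _
    _ ≤ C * Real.exp ((K + K') * ∑ i, |p.1 i|) + C' * Real.exp ((K + K') * ∑ i, |p.1 i|) :=
        add_le_add ((h p).trans (by gcongr)) ((h' p).trans (by gcongr))
    _ = _ := by ring

theorem neg {f : (Fin N → ℝ) × X → ℝ} (hf : ExpBounded f) : ExpBounded fun p => -f p := by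
  obtain ⟨C, K, hC, hK, h⟩ := hf
  exact ⟨C, K, hC, hK, fun p => by rw [abs_neg]; exact h p⟩

theorem sub {f g : (Fin N → ℝ) × X → ℝ} (hf : ExpBounded f) (hg : ExpBounded g) :
    ExpBounded fun p => f p - g p := by
  simpa only [sub_eq_add_neg] using hf.add hg.neg

theorem const (r : ℝ) : ExpBounded fun _ : (Fin N → ℝ) × X => r :=
  ⟨|r|, 0, abs_nonneg _, le_rfl, fun _ => by simp⟩

theorem sum {ι : Type*} {s : Finset ι} {f : ι → (Fin N → ℝ) × X → ℝ}
    (hf : ∀ i ∈ s, ExpBounded (f i)) : ExpBounded fun p => ∑ i ∈ s, f i p := by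
  classical
  induction s using Finset.induction_on with
  | empty => simpa using const 0
  | insert i s hi ih =>
    simp only [Finset.sum_insert hi]
    exact (hf i (Finset.mem_insert_self _ _)).add
      (ih fun j hj => hf j (Finset.mem_insert_of_mem hj))

theorem prod {ι : Type*} {s : Finset ι} {f : ι → (Fin N → ℝ) × X → ℝ}
    (hf : ∀ i ∈ s, ExpBounded (f i)) : ExpBounded fun p => ∏ i ∈ s, f i p := by
  classical
  induction s using Finset.induction_on with
  | empty => simpa using const 1
  | insert i s hi ih =>
    simp only [Finset.prod_insert hi]
    exact (hf i (Finset.mem_insert_self _ _)).mul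
      (ih fun j hj => hf j (Finset.mem_insert_of_mem hj))

theorem exp_sum_mul [TopologicalSpace X] [CompactSpace X] {y : X → Fin N → ℝ}
    (hy : Continuous y) : ExpBounded fun p : (Fin N → ℝ) × X => Real.exp (∑ i, p.1 i * y p.2 i) := by
  obtain ⟨C, hC⟩ := isCompact_univ.exists_bound_of_continuousOn hy.continuousOn
  refine ⟨1, max C 0, zero_le_one, le_max_right _ _, fun p => ?_⟩
  rw [Real.abs_exp, one_mul, Finset.mul_sum]
  refine Real.exp_le_exp.mpr (Finset.sum_le_sum fun i _ => ?_)
  calc p.1 i * y p.2 i ≤ |p.1 i * y p.2 i| := le_abs_self _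
    _ = |p.1 i| * |y p.2 i| := abs_mul _ _
    _ ≤ |p.1 i| * max C 0 := by
        gcongr
        exact ((norm_le_pi_norm (y p.2) i).trans (hC p.2 (Set.mem_univ _))).trans (le_max_left _ _)
    _ = _ := mul_comm _ _

theorem integrable_gaussian {f : (Fin N → ℝ) × Matrix.unitaryGroup (Fin N) ℂ → ℝ}
    (hf : ExpBounded f) (hc : Continuous f) (a : Fin N → ℝ) (v : ℝ≥0) :
    Integrable f ((Measure.pi fun i => gaussianReal (a i) v).prod μ) := by
  obtain ⟨C, K, hC, hK, h⟩ := hf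
  have h1 : Integrable (fun c : Fin N → ℝ => C * Real.exp (K * ∑ i, |c i|))
      (Measure.pi fun i => gaussianReal (a i) v) := by
    simp only [Finset.mul_sum, Real.exp_sum]
    refine (Integrable.fintype_prod (f := fun _ x => Real.exp (K * |x|)) fun i => ?_).const_mul C
    exact integrable_exp_mul_abs (X := id) (integrable_exp_mul_gaussianReal K)
      (integrable_exp_mul_gaussianReal (-K))
  exact (h1.comp_fst μ).mono' hc.aestronglyMeasurable (Filter.Eventually.of_forall h)

end ExpBounded

theorem integral_heat_identity [μ.IsMulLeftInvariant] {B : Matrix (Fin N) (Fin N) ℂ}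
    (hB : B.IsHermitian) (a : Fin N → ℝ) (v : ℝ≥0) :
    ∫ U, (2 * vdmDir (fun i => a i + v * orbitDiag B U i) (orbitDiag B U) -
      offSq B U * vdm fun i => a i + v * orbitDiag B U i) *
      Real.exp (∑ i, (a i * orbitDiag B U i + v * orbitDiag B U i ^ 2 / 2)) ∂μ = 0 := by
  set Γ := Measure.pi fun i => gaussianReal (a i) v
  set F : (Fin N → ℝ) → Matrix.unitaryGroup (Fin N) ℂ → ℝ := fun c U =>
    (2 * vdmDir c (orbitDiag B U) - offSq B U * vdm c) * orbitWeight B c U with hF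
  have hcont : Continuous (Function.uncurry F) := by
    simp only [hF, Function.uncurry_def, orbitWeight]
    fun_prop
  have hd : ∀ i, ExpBounded fun p : (Fin N → ℝ) × Matrix.unitaryGroup (Fin N) ℂ =>
      orbitDiag B p.2 i := fun i =>
      .of_continuous (continuous_orbitDiag_apply B i)
  have hbdd : ExpBounded (Function.uncurry F) := by
    refine ExpBounded.mul (.sub (.mul (.const 2) (.sum fun p _ => .mul (.prod fun q _ =>
      .sub (.fst_apply _) (.fst_apply _)) (.sub (hd _) (hd _)))) (.mul (.of_continuous
      (continuous_offSq B)) (.prod fun p _ => .sub (.fst_apply _) (.fst_apply _)))) ?_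
    exact .exp_sum_mul (continuous_orbitDiag B)
  have hswap := integral_integral_swap (μ := Γ) (ν := μ) (f := F)
    (hbdd.integrable_gaussian hcont a v)
  have h0 : ∀ c, ∫ U, F c U ∂μ = 0 := integral_vdm_identity hB
  simp only [h0, integral_zero] at hswap
  rw [hswap]
  refine integral_congr_ae (Filter.Eventually.of_forall fun U => ?_)
  have h1 := integral_vdm_gaussian a (orbitDiag B U) v
  have h2 := integral_vdmDir_gaussian a (orbitDiag B U) (orbitDiag B U) v
  have h3 : ∀ c, F c U = 2 * (vdmDir c (orbitDiag B U) * Real.exp (∑ i, c i * orbitDiag B U i)) -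
      offSq B U * (vdm c * Real.exp (∑ i, c i * orbitDiag B U i)) := fun c => by
    simp only [hF, orbitWeight]; ring
  simp only [h3]
  rw [integral_sub (h2.1.const_mul _) (h1.1.const_mul _), integral_const_mul, integral_const_mul,
    h1.2, h2.2]
  ring

theorem integral_heat_constant [μ.IsMulLeftInvariant] {B : Matrix (Fin N) (Fin N) ℂ}
    (hB : B.IsHermitian) (a : Fin N → ℝ) {v : ℝ} (hv : 0 ≤ v) :
    ∫ U, (vdm fun i => a i + v * orbitDiag B U i) * (orbitWeight B a U *
      Real.exp (-(v * (offSq B U / 2)))) ∂μ = vdm a * ∫ U, orbitWeight B a U ∂μ := by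
  set Ψ : ℝ → ℝ := fun v => ∫ U, (vdm fun i => a i + v * orbitDiag B U i) * (orbitWeight B a U *
      Real.exp (-(v * (offSq B U / 2)))) ∂μ with hΨ
  have hder : ∀ t, HasDerivAt Ψ (∫ U, (vdmDir (fun i => a i + t * orbitDiag B U i) (orbitDiag B U) *
      (orbitWeight B a U * Real.exp (-(t * (offSq B U / 2)))) +
      (vdm fun i => a i + t * orbitDiag B U i) * (orbitWeight B a U *
      (Real.exp (-(t * (offSq B U / 2))) * -(offSq B U / 2)))) ∂μ) t := by
    refine hasDerivAt_integral_of_compactSpace (fun t => by fun_prop)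
      (by simp only [Function.uncurry_def]; fun_prop) fun t U => ?_
    refine HasDerivAt.mul (hasDerivAt_vdm fun i => ?_) (HasDerivAt.const_mul _ (HasDerivAt.exp ?_))
    · exact (hasDerivAt_mul_const _).const_add _
    · exact (hasDerivAt_mul_const _).neg
  have hzero : ∀ t, 0 ≤ t → HasDerivAt Ψ 0 t := fun t ht => by
    lift t to ℝ≥0 using ht
    convert hder t using 1
    have h := integral_heat_identity (μ := μ) hB a t
    rw [← mul_zero (Real.exp (-(t * (((B * B).trace).re / 2))) / 2), ← h, ← integral_const_mul]
    refine integral_congr_ae (Filter.Eventually.of_forall fun U => ?_)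
    have he : Real.exp (-(t * (((B * B).trace).re / 2))) *
        Real.exp (∑ i, (a i * orbitDiag B U i + t * orbitDiag B U i ^ 2 / 2)) =
        orbitWeight B a U * Real.exp (-(t * (offSq B U / 2))) := by
      rw [orbitWeight, ← Real.exp_add, ← Real.exp_add, ← sum_sq_orbitDiag_add_offSq hB U,
        Finset.sum_add_distrib, ← Finset.sum_div, ← Finset.mul_sum]
      congr 1
      ring
    linear_combination (vdmDir (fun i => a i + t * orbitDiag B U i) (orbitDiag B U) -
      offSq B U / 2 * vdm fun i => a i + t * orbitDiag B U i) * he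
  have hconst := constant_of_has_deriv_right_zero (f := Ψ) (a := 0) (b := v)
    (fun t ht => (hzero t ht.1).continuousAt.continuousWithinAt)
    (fun t ht => (hzero t ht.1).hasDerivWithinAt) v ⟨hv, le_rfl⟩
  simp only [hΨ, zero_mul, neg_zero, Real.exp_zero, mul_one, add_zero] at hconst
  rw [hconst, integral_const_mul]

end Integral

end GaussianTransform

section Concentration

open Filter Topology

theorem nonneg_of_laplace_eq_const {X : Type*} [TopologicalSpace X] [CompactSpace X]
    [MeasurableSpace X] [OpensMeasurableSpace X] {μ : Measure X} [IsFiniteMeasure μ]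
    {F : ℝ × X → ℝ} {g : X → ℝ} (hF : Continuous F) (hg : Continuous g) (hg0 : ∀ x, 0 ≤ g x)
    (hpos : ∀ x, g x = 0 → 0 < F (0, x)) (n : ℕ) {p : ℝ}
    (hp : ∀ v : ℝ, 0 < v → v ^ n * ∫ x, F (v⁻¹, x) * Real.exp (-(v * g x)) ∂μ = p) : 0 ≤ p := by
  have hcI : IsCompact (Set.Icc (0 : ℝ) 1 ×ˢ (Set.univ : Set X)) := isCompact_Icc.prod isCompact_univ
  obtain ⟨C, hC⟩ := hcI.exists_bound_of_continuousOn hF.continuousOn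
  obtain ⟨m, hm, hmF⟩ : ∃ m : ℝ, 0 < m ∧ ∀ t x, 0 ≤ t → t ≤ 1 → t < m → g x < m → 0 ≤ F (t, x) := by
    set K := (Set.Icc (0 : ℝ) 1 ×ˢ (Set.univ : Set X)) ∩ {q | F q ≤ 0} with hK
    have hKc : IsCompact K := hcI.inter_right (isClosed_le hF continuous_const)
    rcases K.eq_empty_or_nonempty with he | hne
    · refine ⟨1, one_pos, fun t x h0 h1 _ _ => ?_⟩
      by_contra! hlt
      have : (t, x) ∈ K := ⟨⟨⟨h0, h1⟩, Set.mem_univ _⟩, hlt.le⟩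
      rw [he] at this
      exact this
    · obtain ⟨q, hq, hmin⟩ := hKc.exists_isMinOn hne
        (f := fun q : ℝ × X => max q.1 (g q.2)) (by fun_prop)
      refine ⟨max q.1 (g q.2), ?_, fun t x h0 h1 ht hx => ?_⟩
      · by_contra! hle
        have h1 : q.1 = 0 := le_antisymm ((le_max_left _ _).trans hle) hq.1.1.1
        have h2 : g q.2 = 0 := le_antisymm ((le_max_right _ _).trans hle) (hg0 _)
        have h3 := hpos q.2 h2
        have h4 : q = (0, q.2) := Prod.ext h1 rfl
        rw [← h4] at h3
        exact absurd hq.2 (not_le.mpr h3)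
      · by_contra! hlt
        have : (t, x) ∈ K := ⟨⟨⟨h0, h1⟩, Set.mem_univ _⟩, hlt.le⟩
        exact absurd (hmin this) (not_le.mpr (max_lt ht hx))
  have hlow : ∀ v : ℝ, max 1 m⁻¹ < v → -(C * μ.real Set.univ) * (v ^ n * Real.exp (-m * v)) ≤ p := by
    intro v hv
    have hv1 : 1 < v := (le_max_left _ _).trans_lt hv
    have hv0 : 0 < v := one_pos.trans hv1
    have hvm : v⁻¹ < m := inv_lt_of_inv_lt₀ hm ((le_max_right _ _).trans_lt hv)
    have hvi : v⁻¹ ≤ 1 := inv_le_one_of_one_le₀ hv1.le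
    have hpt : ∀ x, -(C * Real.exp (-m * v)) ≤ F (v⁻¹, x) * Real.exp (-(v * g x)) := fun x => by
      have hb := hC (v⁻¹, x) ⟨⟨(inv_pos.mpr hv0).le, hvi⟩, Set.mem_univ _⟩
      have hC0 : 0 ≤ C := (norm_nonneg _).trans hb
      rcases lt_or_ge (g x) m with hx | hx
      · have := hmF _ x (inv_pos.mpr hv0).le hvi hvm hx
        have h2 : 0 ≤ F (v⁻¹, x) * Real.exp (-(v * g x)) := mul_nonneg this (Real.exp_pos _).le
        have h3 : 0 ≤ C * Real.exp (-m * v) := mul_nonneg hC0 (Real.exp_pos _).le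
        linarith
      · have h1 : Real.exp (-(v * g x)) ≤ Real.exp (-m * v) := by
          refine Real.exp_le_exp.mpr ?_
          nlinarith
        refine (abs_le.mp ?_).1
        rw [abs_mul, Real.abs_exp]
        exact mul_le_mul hb h1 (Real.exp_pos _).le hC0
    have hint := integral_mono (μ := μ) (integrable_const _)
      (integrable_of_continuous_of_compactSpace (by fun_prop)) hpt
    rw [integral_const, smul_eq_mul] at hint
    rw [← hp v hv0]
    have := mul_le_mul_of_nonneg_left hint (pow_nonneg hv0.le n)
    linarith
  have hlim := (tendsto_rpow_mul_exp_neg_mul_atTop_nhds_zero n m hm).const_mul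
    (-(C * μ.real Set.univ))
  simp only [Real.rpow_natCast, mul_zero] at hlim
  exact le_of_tendsto hlim ((eventually_gt_atTop _).mono hlow)

theorem eq_zero_of_laplace_eq_const {X : Type*} [TopologicalSpace X] [CompactSpace X]
    [MeasurableSpace X] [OpensMeasurableSpace X] {μ : Measure X} [IsFiniteMeasure μ]
    {P H : ℝ × X → ℝ} {g : X → ℝ} (hP : Continuous P) (hH : Continuous H) (hg : Continuous g)
    (hg0 : ∀ x, 0 ≤ g x) (hpos : ∀ x, g x = 0 → 0 < P (0, x)) (hzero : ∀ x, g x = 0 → H (0, x) = 0)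
    (n : ℕ) {p h : ℝ}
    (hp : ∀ v : ℝ, 0 < v → v ^ n * ∫ x, P (v⁻¹, x) * Real.exp (-(v * g x)) ∂μ = p)
    (hh : ∀ v : ℝ, 0 < v → v ^ n * ∫ x, H (v⁻¹, x) * Real.exp (-(v * g x)) ∂μ = h) : h = 0 := by
  have key : ∀ ε : ℝ, 0 < ε → ∀ s : ℝ, 0 ≤ ε * p + s * h := fun ε hε s => by
    refine nonneg_of_laplace_eq_const (μ := μ) (F := fun q => ε * P q + s * H q) (g := g)
      (by fun_prop) hg hg0 (fun x hx => ?_) n fun v hv => ?_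
    · rw [hzero x hx, mul_zero, add_zero]
      exact mul_pos hε (hpos x hx)
    · simp only [add_mul, mul_assoc]
      rw [integral_add (integrable_of_continuous_of_compactSpace (by fun_prop))
        (integrable_of_continuous_of_compactSpace (by fun_prop)), integral_const_mul,
        integral_const_mul, ← hp v hv, ← hh v hv]
      ring
  have hp0 := key 1 one_pos 0
  by_contra hne
  have h1 : 0 < |h| := abs_pos.mpr hne
  have h2 := key (|h| / (2 * (p + 1))) (by
    have : 0 ≤ p := by linarith
    positivity) (-SignType.sign h)
  have hp1 : 0 < p + 1 := by linarith
  have h3 : |h| / (2 * (p + 1)) * p ≤ |h| / 2 := by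
    rw [div_mul_eq_mul_div, div_le_div_iff₀ (by positivity) two_pos]
    nlinarith
  rw [neg_mul, sign_mul_self] at h2
  linarith

end Concentration

section Symmetry

variable {N : ℕ}

theorem vdm_comp_perm (c : Fin N → ℝ) (σ : Equiv.Perm (Fin N)) :
    vdm (fun i => c (σ i)) = Equiv.Perm.sign σ * vdm c := by
  rw [vdm_eq_det, vdm_eq_det]
  exact_mod_cast det_permute σ (vandermonde c)

theorem vdm_smul (r : ℝ) (c : Fin N → ℝ) :
    vdm (fun i => r * c i) = r ^ (pairs N).card * vdm c := by
  simp only [vdm, ← mul_sub, Finset.prod_mul_distrib, Finset.prod_const]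

theorem permMatrix_mem_unitaryGroup (σ : Equiv.Perm (Fin N)) :
    σ.permMatrix ℂ ∈ Matrix.unitaryGroup (Fin N) ℂ := by
  rw [Matrix.mem_unitaryGroup_iff, Matrix.star_eq_conjTranspose, conjTranspose_permMatrix,
    ← permMatrix_mul]
  simp

theorem orbitDiag_permMatrix_mul (B : Matrix (Fin N) (Fin N) ℂ) (σ : Equiv.Perm (Fin N))
    (U : Matrix.unitaryGroup (Fin N) ℂ) (i : Fin N) :
    orbitDiag B (⟨σ.permMatrix ℂ, permMatrix_mem_unitaryGroup σ⟩ * U) i = orbitDiag B U (σ i) := by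
  have h1 : ∀ M : Matrix (Fin N) (Fin N) ℂ, σ.permMatrix ℂ * M = M.submatrix σ id :=
    PEquiv.toMatrix_toPEquiv_mul σ
  have h2 : ∀ M : Matrix (Fin N) (Fin N) ℂ, M * σ⁻¹.permMatrix ℂ = M.submatrix id σ := fun M =>
    PEquiv.mul_toMatrix_toPEquiv M σ⁻¹
  rw [orbitDiag, orbitPoint_mul, Matrix.star_eq_conjTranspose, conjTranspose_permMatrix, h1, h2]
  rfl

theorem integral_orbitWeight_perm {μ : Measure (Matrix.unitaryGroup (Fin N) ℂ)}
    [μ.IsMulLeftInvariant] (B : Matrix (Fin N) (Fin N) ℂ) (a : Fin N → ℝ)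
    (σ : Equiv.Perm (Fin N)) :
    ∫ U, orbitWeight B (fun i => a (σ i)) U ∂μ = ∫ U, orbitWeight B a U ∂μ := by
  rw [← integral_mul_left_eq_self (orbitWeight B a)
    ⟨σ⁻¹.permMatrix ℂ, permMatrix_mem_unitaryGroup σ⁻¹⟩]
  refine integral_congr_ae (Filter.Eventually.of_forall fun U => ?_)
  simp only [orbitWeight, orbitDiag_permMatrix_mul]
  congr 1
  exact Fintype.sum_equiv σ _ _ fun i => by simp

theorem exists_perm_of_offSq_eq_zero {B : Matrix (Fin N) (Fin N) ℂ} (hB : B.IsHermitian)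
    {b : Fin N → ℝ} (hb : Function.Injective b) {e : Equiv.Perm (Fin N)}
    (he : ∀ i, hB.eigenvalues (e i) = b i) {U : Matrix.unitaryGroup (Fin N) ℂ}
    (hU : offSq B U = 0) : ∃ σ : Equiv.Perm (Fin N), ∀ i, orbitDiag B U (σ i) = b i := by
  have hoff : ∀ p ∈ pairs N, orbitPoint B U p.1 p.2 = 0 := fun p hp => by
    rw [offSq, mul_eq_zero] at hU
    have := (Finset.sum_eq_zero_iff_of_nonneg fun _ _ => Complex.normSq_nonneg _).mp
      (hU.resolve_left two_ne_zero) p hp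
    exact Complex.normSq_eq_zero.mp this
  have hdiag : orbitPoint B U = diagonal fun i => (orbitDiag B U i : ℂ) := by
    ext i j
    rcases lt_trichotomy i j with h | h | h
    · rw [diagonal_apply_ne _ h.ne]
      exact hoff (i, j) (by simp [pairs, h])
    · subst h
      rw [diagonal_apply_eq]
      exact ((orbitPoint_isHermitian hB U).coe_re_apply_self i).symm
    · rw [diagonal_apply_ne _ h.ne', orbitPoint_swap hB U j i, hoff (j, i) (by simp [pairs, h]),
        star_zero]
  have hchar : (orbitPoint B U).charpoly = B.charpoly := by
    rw [orbitPoint, Matrix.charpoly_mul_comm, ← Matrix.mul_assoc,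
      Matrix.mem_unitaryGroup_iff'.mp U.2, Matrix.one_mul]
  have hroot : ∀ j, ∃ i, orbitDiag B U i = b j := fun j => by
    have h1 : B.charpoly.eval (b j : ℂ) = 0 := by
      rw [hB.charpoly_eq, Polynomial.eval_prod]
      exact Finset.prod_eq_zero (Finset.mem_univ (e j)) (by simp [he])
    rw [← hchar, hdiag, charpoly_diagonal, Polynomial.eval_prod] at h1
    obtain ⟨i, -, hi⟩ := Finset.prod_eq_zero_iff.mp h1
    refine ⟨i, ?_⟩
    simp only [Polynomial.eval_sub, Polynomial.eval_X, Polynomial.eval_C, sub_eq_zero] at hi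
    exact_mod_cast hi.symm
  choose s hs using hroot
  have hinj : Function.Injective s := fun i j hij => hb (by rw [← hs i, ← hs j, hij])
  exact ⟨Equiv.ofBijective s (Finite.injective_iff_bijective.mp hinj), hs⟩

end Symmetry

section Formula

variable {N : ℕ} {μ : Measure (Matrix.unitaryGroup (Fin N) ℂ)} [μ.IsMulLeftInvariant]
  [IsFiniteMeasure μ]

/-- The antisymmetrized integrand. -/
noncomputable def antisymWeight (B : Matrix (Fin N) (Fin N) ℂ) (a : Fin N → ℝ)
    (q : ℝ × Matrix.unitaryGroup (Fin N) ℂ) : ℝ :=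
  ∑ σ : Equiv.Perm (Fin N), (Equiv.Perm.sign σ : ℝ) *
    ((vdm fun i => q.1 * a (σ i) + orbitDiag B q.2 i) * orbitWeight B (fun i => a (σ i)) q.2)

@[fun_prop]
theorem continuous_antisymWeight (B : Matrix (Fin N) (Fin N) ℂ) (a : Fin N → ℝ) :
    Continuous (antisymWeight B a) := by
  unfold antisymWeight; fun_prop

theorem integral_antisymWeight {B : Matrix (Fin N) (Fin N) ℂ} (hB : B.IsHermitian)
    (a : Fin N → ℝ) {v : ℝ} (hv : 0 < v) :
    v ^ (pairs N).card * ∫ U, antisymWeight B a (v⁻¹, U) * Real.exp (-(v * (offSq B U / 2))) ∂μ =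
      (N.factorial : ℝ) * (vdm a * ∫ U, orbitWeight B a U ∂μ) := by
  simp only [antisymWeight, Finset.sum_mul]
  rw [integral_finsetSum _ fun σ _ => integrable_of_continuous_of_compactSpace (by fun_prop),
    Finset.mul_sum]
  have h : ∀ σ : Equiv.Perm (Fin N), v ^ (pairs N).card * ∫ U, (Equiv.Perm.sign σ : ℝ) *
      ((vdm fun i => v⁻¹ * a (σ i) + orbitDiag B U i) * orbitWeight B (fun i => a (σ i)) U) *
      Real.exp (-(v * (offSq B U / 2))) ∂μ = vdm a * ∫ U, orbitWeight B a U ∂μ := fun σ => by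
    have h1 := integral_heat_constant (μ := μ) hB (fun i => a (σ i)) hv.le
    have h2 : ∀ U, (vdm fun i => a (σ i) + v * orbitDiag B U i) =
        v ^ (pairs N).card * vdm fun i => v⁻¹ * a (σ i) + orbitDiag B U i := fun U => by
      rw [← vdm_smul]
      congr 1
      ext i
      field_simp
    have h3 : ((Equiv.Perm.sign σ : ℤ) : ℝ) * ((Equiv.Perm.sign σ : ℤ) : ℝ) = 1 := by
      exact_mod_cast Int.units_coe_mul_self _
    simp only [h2, mul_assoc] at h1
    rw [integral_const_mul, integral_orbitWeight_perm, vdm_comp_perm] at h1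
    simp only [mul_assoc]
    rw [integral_const_mul]
    linear_combination (Equiv.Perm.sign σ : ℝ) * h1 + (vdm a * ∫ U, orbitWeight B a U ∂μ) * h3
  rw [Finset.sum_congr rfl fun σ _ => h σ, Finset.sum_const, Finset.card_univ, Fintype.card_perm,
    Fintype.card_fin, nsmul_eq_mul]

theorem antisymWeight_zero {B : Matrix (Fin N) (Fin N) ℂ} (hB : B.IsHermitian)
    {b : Fin N → ℝ} (hb : Function.Injective b) {e : Equiv.Perm (Fin N)}
    (he : ∀ i, hB.eigenvalues (e i) = b i) (a : Fin N → ℝ) {U : Matrix.unitaryGroup (Fin N) ℂ}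
    (hU : offSq B U = 0) :
    antisymWeight B a (0, U) = vdm b * (Matrix.of fun i j => Real.exp (a i * b j)).det := by
  obtain ⟨τ, hτ⟩ := exists_perm_of_offSq_eq_zero hB hb he hU
  have h1 : antisymWeight B a (0, U) = vdm (orbitDiag B U) *
      (Matrix.of fun i j => Real.exp (a i * orbitDiag B U j)).det := by
    rw [det_apply', antisymWeight, Finset.mul_sum]
    refine Finset.sum_congr rfl fun σ _ => ?_
    simp only [zero_mul, zero_add, orbitWeight, Real.exp_sum, of_apply]
    ring
  have h2 : vdm b = Equiv.Perm.sign τ * vdm (orbitDiag B U) := by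
    rw [← vdm_comp_perm]
    simp only [hτ]
  have h3 : (Matrix.of fun i j => Real.exp (a i * b j)).det = Equiv.Perm.sign τ *
      (Matrix.of fun i j => Real.exp (a i * orbitDiag B U j)).det := by
    rw [← det_permute']
    congr 1
    ext i j
    simp [hτ]
  have h4 : ((Equiv.Perm.sign τ : ℤ) : ℝ) * ((Equiv.Perm.sign τ : ℤ) : ℝ) = 1 := by
    exact_mod_cast Int.units_coe_mul_self _
  rw [h1, h2, h3]
  linear_combination -(vdm (orbitDiag B U) *
      (Matrix.of fun i j => Real.exp (a i * orbitDiag B U j)).det) * h4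

/-- The Harish-Chandra–Itzykson–Zuber formula, up to normalization. -/
theorem vdm_mul_integral_orbitWeight {B : Matrix (Fin N) (Fin N) ℂ} (hB : B.IsHermitian)
    {b : Fin N → ℝ} (hb : Function.Injective b) {e : Equiv.Perm (Fin N)}
    (he : ∀ i, hB.eigenvalues (e i) = b i) (a a₀ : Fin N → ℝ)
    (ha₀ : (Matrix.of fun i j => Real.exp (a₀ i * b j)).det ≠ 0) :
    (Matrix.of fun i j => Real.exp (a₀ i * b j)).det * (vdm a * ∫ U, orbitWeight B a U ∂μ) =
      (Matrix.of fun i j => Real.exp (a i * b j)).det *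
        (vdm a₀ * ∫ U, orbitWeight B a₀ U ∂μ) := by
  have hvb : vdm b ≠ 0 := by rwa [vdm_eq_det, det_vandermonde_ne_zero_iff]
  set θ : (Fin N → ℝ) → ℝ := fun a => vdm b * (Matrix.of fun i j => Real.exp (a i * b j)).det
    with hθ
  have hθ₀ : θ a₀ ≠ 0 := mul_ne_zero hvb ha₀
  have hz : ∀ U, offSq B U / 2 = 0 → ∀ a, antisymWeight B a (0, U) = θ a := fun U hU a =>
    antisymWeight_zero hB hb he a (by linarith)
  have key := eq_zero_of_laplace_eq_const (μ := μ) (g := fun U => offSq B U / 2)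
    (P := fun q => θ a₀ * antisymWeight B a₀ q)
    (H := fun q => θ a₀ * antisymWeight B a q - θ a * antisymWeight B a₀ q)
    (p := θ a₀ * (N.factorial * (vdm a₀ * ∫ U, orbitWeight B a₀ U ∂μ)))
    (h := θ a₀ * (N.factorial * (vdm a * ∫ U, orbitWeight B a U ∂μ)) -
      θ a * (N.factorial * (vdm a₀ * ∫ U, orbitWeight B a₀ U ∂μ)))
    (by fun_prop) (by fun_prop) (by fun_prop) (fun U => div_nonneg (offSq_nonneg B U) zero_le_two)
    (fun U hU => by rw [hz U hU]; exact mul_self_pos.mpr hθ₀)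
    (fun U hU => by rw [hz U hU, hz U hU]; ring) (pairs N).card
    (fun v hv => by
      simp only [mul_assoc]
      rw [integral_const_mul, ← integral_antisymWeight hB a₀ hv]
      ring)
    (fun v hv => by
      simp only [sub_mul, mul_assoc]
      rw [integral_sub (integrable_of_continuous_of_compactSpace (by fun_prop))
        (integrable_of_continuous_of_compactSpace (by fun_prop)), integral_const_mul,
        integral_const_mul, ← integral_antisymWeight hB a₀ hv, ← integral_antisymWeight hB a hv]
      ring)
  have hN : (N.factorial : ℝ) ≠ 0 := by exact_mod_cast N.factorial_ne_zero
  simp only [hθ] at key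
  refine mul_left_cancel₀ (mul_ne_zero hvb hN) ?_
  linear_combination key

end Formula

section Zeros

variable {N : ℕ} {μ : Measure (Matrix.unitaryGroup (Fin N) ℂ)}

theorem hciz_eq_integral_orbitDiag [μ.IsMulLeftInvariant] {A : Matrix (Fin N) (Fin N) ℂ}
    (B : Matrix (Fin N) (Fin N) ℂ) (hA : A.IsHermitian) (hB : B.IsHermitian) {a : Fin N → ℝ}
    {e : Equiv.Perm (Fin N)} (he : ∀ i, hA.eigenvalues (e i) = a i) (z : ℂ) :
    hciz μ A B z =
      ∫ U, Complex.exp (-(z * N * ((∑ i, a i * orbitDiag B U i : ℝ) : ℂ))) ∂μ := by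
  rw [← integral_mul_left_eq_self _ ((⟨e.permMatrix ℂ, permMatrix_mem_unitaryGroup e⟩ :
    Matrix.unitaryGroup (Fin N) ℂ) * (hA.eigenvectorUnitary)⁻¹), hciz]
  refine integral_congr_ae (Filter.Eventually.of_forall fun U => ?_)
  simp only
  congr 3
  set V := hA.eigenvectorUnitary with hV
  have h1 : (A * U.1 * B * (U⁻¹).1).trace =
      (diagonal (fun i => (hA.eigenvalues i : ℂ)) * orbitPoint B (V⁻¹ * U)).trace := by
    have hs : A = V.1 * diagonal (fun i => (hA.eigenvalues i : ℂ)) * star V.1 := by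
      conv_lhs => rw [hA.spectral_theorem]
      rfl
    conv_lhs => rw [hs]
    rw [orbitPoint_mul, orbitPoint]
    simp only [Matrix.UnitaryGroup.inv_val, star_star, Matrix.mul_assoc]
    rw [Matrix.trace_mul_comm]
    simp only [Matrix.mul_assoc]
  rw [h1, mul_assoc]
  simp only [orbitDiag_permMatrix_mul]
  rw [Matrix.trace]
  simp only [diag_apply, diagonal_mul]
  push_cast
  refine (Fintype.sum_equiv e _ _ fun i => ?_).symm
  rw [he]
  congr 1
  exact (orbitPoint_isHermitian hB _).coe_re_apply_self _

theorem hciz_ofReal [μ.IsMulLeftInvariant] {A : Matrix (Fin N) (Fin N) ℂ}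
    (B : Matrix (Fin N) (Fin N) ℂ) (hA : A.IsHermitian) (hB : B.IsHermitian) {a : Fin N → ℝ}
    {e : Equiv.Perm (Fin N)} (he : ∀ i, hA.eigenvalues (e i) = a i) (x : ℝ) :
    hciz μ A B x = ((∫ U, orbitWeight B (fun i => -(x * N) * a i) U ∂μ : ℝ) : ℂ) := by
  rw [hciz_eq_integral_orbitDiag B hA hB he, ← integral_complex_ofReal]
  refine integral_congr_ae (Filter.Eventually.of_forall fun U => ?_)
  simp only [orbitWeight, Complex.ofReal_exp]
  congr 1
  push_cast
  rw [Finset.mul_sum, ← Finset.sum_neg_distrib]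
  exact Finset.sum_congr rfl fun i _ => by ring

theorem differentiable_hciz [μ.IsMulLeftInvariant] [IsFiniteMeasure μ]
    {A : Matrix (Fin N) (Fin N) ℂ}
    (B : Matrix (Fin N) (Fin N) ℂ) (hA : A.IsHermitian) (hB : B.IsHermitian) {a : Fin N → ℝ}
    {e : Equiv.Perm (Fin N)} (he : ∀ i, hA.eigenvalues (e i) = a i) :
    Differentiable ℂ (hciz μ A B) := by
  rw [funext (hciz_eq_integral_orbitDiag (μ := μ) B hA hB he)]
  set s : Matrix.unitaryGroup (Fin N) ℂ → ℂ := fun U => ((∑ i, a i * orbitDiag B U i : ℝ) : ℂ)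
    with hs
  have hsc : Continuous s := by rw [hs]; fun_prop
  have := hasDerivAt_integral_of_compactSpace (𝕜 := ℂ) (μ := μ)
    (F := fun z U => Complex.exp (-(z * N * s U)))
    (F' := fun z U => Complex.exp (-(z * N * s U)) * -(1 * N * s U)) (fun z => by fun_prop)
    (by simp only [Function.uncurry_def]; fun_prop)
    (fun z U => ((((hasDerivAt_id z).mul_const (N : ℂ)).mul_const (s U)).neg).cexp)
  exact fun z => (this z).differentiableAt

theorem eq_of_eq_ofReal {f g : ℂ → ℂ} (hf : Differentiable ℂ f) (hg : Differentiable ℂ g)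
    (h : ∀ x : ℝ, f x = g x) : f = g := by
  have hfa : AnalyticOnNhd ℂ f Set.univ := fun z _ => hf.analyticAt z
  have hga : AnalyticOnNhd ℂ g Set.univ := fun z _ => hg.analyticAt z
  refine hfa.eq_of_frequently_eq hga (z₀ := 0) ?_
  have ht : Filter.Tendsto (fun x : ℝ => (x : ℂ)) (nhdsWithin 0 {0}ᶜ) (nhdsWithin 0 {0}ᶜ) := by
    refine tendsto_nhdsWithin_iff.mpr ⟨?_, ?_⟩
    · exact (Complex.continuous_ofReal.tendsto' 0 0 Complex.ofReal_zero).mono_left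
        nhdsWithin_le_nhds
    · filter_upwards [self_mem_nhdsWithin] with x hx
      simpa using hx
  exact ht.frequently (Filter.Frequently.of_forall h)

theorem det_exp_arithmetic (a₁ ℏ : ℝ) (b : Fin N → ℝ) (w : ℂ) :
    (Matrix.of fun i j : Fin N =>
      Complex.exp (w * ((a₁ + (i : ℕ) * ℏ : ℝ) : ℂ) * b j)).det =
      (∏ j, Complex.exp (w * a₁ * b j)) *
        (vandermonde fun j => Complex.exp (w * ℏ * b j)).det := by
  rw [← det_transpose, ← det_mul_column]
  congr 1
  ext j i
  simp only [transpose_apply, of_apply, vandermonde_apply]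
  rw [← Complex.exp_nat_mul, ← Complex.exp_add]
  congr 1
  push_cast
  ring

theorem det_exp_arithmetic_eq_zero_iff (a₁ ℏ : ℝ) (b : Fin N → ℝ) (w : ℂ) :
    (Matrix.of fun i j : Fin N =>
      Complex.exp (w * ((a₁ + (i : ℕ) * ℏ : ℝ) : ℂ) * b j)).det = 0 ↔
      ∃ i j : Fin N, i < j ∧ ∃ k : ℤ, w * ℏ * (b i - b j) = k * (2 * Real.pi * Complex.I) := by
  have hne : ∏ j, Complex.exp (w * a₁ * b j) ≠ 0 :=
    Finset.prod_ne_zero_iff.mpr fun _ _ => Complex.exp_ne_zero _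
  rw [det_exp_arithmetic, mul_eq_zero, or_iff_right hne, det_vandermonde_eq_zero_iff]
  have key : ∀ i j : Fin N, Complex.exp (w * ℏ * b i) = Complex.exp (w * ℏ * b j) ↔
      ∃ k : ℤ, w * ℏ * (b i - b j) = k * (2 * Real.pi * Complex.I) := fun i j => by
    rw [Complex.exp_eq_exp_iff_exists_int]
    refine exists_congr fun k => ?_
    rw [mul_sub, sub_eq_iff_eq_add']
  constructor
  · rintro ⟨i, j, hij, hne⟩
    rcases lt_or_gt_of_ne hne with h | h
    · exact ⟨i, j, h, (key i j).mp hij⟩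
    · exact ⟨j, i, h, (key j i).mp hij.symm⟩
  · rintro ⟨i, j, hij, hk⟩
    exact ⟨i, j, (key i j).mpr hk, hij.ne⟩

theorem ofReal_det_exp (w : ℝ) (a b : Fin N → ℝ) :
    (((Matrix.of fun i j => Real.exp (w * a i * b j)).det : ℝ) : ℂ) =
      (Matrix.of fun i j => Complex.exp (w * (a i : ℂ) * b j)).det := by
  have := RingHom.map_det Complex.ofRealHom (Matrix.of fun i j => Real.exp (w * a i * b j))
  refine this.trans ?_
  congr 1
  ext i j
  simp

end Zeros

/-- **Lee–Yang theorem for the HCIZ integral.**  If the eigenvalues of the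
Hermitian matrix `A` form an arithmetic progression with gap `ℏ > 0` and the
Hermitian matrix `B` has distinct eigenvalues `b 0 < ⋯ < b (N-1)`, then the
zeros of `I_N(·;A,B)` are exactly the pure imaginary points
`2kπ/(Nℏ(b j - b i)) √-1` for `i < j` and `k ∈ ℤ`, `k ≠ 0`. -/
theorem lee_yang (N : ℕ) (hN : 1 ≤ N)
    (μ : Measure (Matrix.unitaryGroup (Fin N) ℂ))
    (hμ : μ.IsHaarMeasure) (hμprob : IsProbabilityMeasure μ)
    (A B : Matrix (Fin N) (Fin N) ℂ)
    (hA : A.IsHermitian) (hB : B.IsHermitian)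
    (a₁ ℏ : ℝ) (hℏ : 0 < ℏ)
    (eA : Equiv.Perm (Fin N))
    (ha : ∀ i : Fin N, hA.eigenvalues (eA i) = a₁ + (i : ℕ) * ℏ)
    (b : Fin N → ℝ) (hb : StrictMono b)
    (eB : Equiv.Perm (Fin N)) (hbe : ∀ i : Fin N, hB.eigenvalues (eB i) = b i) :
    ∀ z : ℂ, hciz μ A B z = 0 ↔
      ∃ i j : Fin N, i < j ∧ ∃ k : ℤ, k ≠ 0 ∧
        z = ((2 * (k : ℝ) * Real.pi / (N * ℏ * (b j - b i)) : ℝ) : ℂ) * Complex.I := by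
  have hprob := hμprob
  have hinv : μ.IsMulLeftInvariant := hμ.toIsMulLeftInvariant
  have hN0 : (N : ℝ) ≠ 0 := by exact_mod_cast (by omega : N ≠ 0)
  set a : Fin N → ℝ := fun i => a₁ + (i : ℕ) * ℏ with ha_def
  have ha_inj : Function.Injective a := fun i j hij => by
    have : ((i : ℕ) : ℝ) = (j : ℕ) := mul_right_cancel₀ hℏ.ne' (add_left_cancel hij)
    exact Fin.ext (by exact_mod_cast this)
  have hvdm : ∀ r : ℝ, r ≠ 0 → vdm (fun i => r * a i) ≠ 0 := fun r hr => by
    rw [vdm_eq_det, det_vandermonde_ne_zero_iff]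
    exact fun i j hij => ha_inj (mul_left_cancel₀ hr hij)
  have hdet : ∀ w : ℝ, w ≠ 0 → (Matrix.of fun i j => Real.exp (w * a i * b j)).det ≠ 0 := by
    intro w hw h0
    have h1 := ofReal_det_exp w a b
    rw [h0, Complex.ofReal_zero] at h1
    obtain ⟨i, j, hij, k, hk⟩ := (det_exp_arithmetic_eq_zero_iff a₁ ℏ b w).mp h1.symm
    have h2 := congrArg Complex.re hk
    have h3 : w * ℏ * (b i - b j) = 0 := by
      have e1 : ((w : ℂ) * ℏ * (b i - b j)) = ((w * ℏ * (b i - b j) : ℝ) : ℂ) := by push_cast; ring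
      have e2 : ((k : ℂ) * (2 * Real.pi * Complex.I)) =
          ((k * (2 * Real.pi) : ℝ) : ℂ) * Complex.I := by push_cast; ring
      rw [e1, e2, Complex.ofReal_re, Complex.re_ofReal_mul, Complex.I_re, mul_zero] at h2
      exact h2
    exact mul_ne_zero (mul_ne_zero hw hℏ.ne') (sub_ne_zero.mpr (hb hij).ne) h3
  set D₀ : ℝ := (Matrix.of fun i j => Real.exp (-N * a i * b j)).det with hD₀
  set K : ℝ := vdm (fun i => -N * a i) * ∫ U, orbitWeight B (fun i => -N * a i) U ∂μ with hK
  have hD₀_ne : D₀ ≠ 0 := hdet (-N) (neg_ne_zero.mpr hN0)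
  have hK_ne : K ≠ 0 := by
    refine mul_ne_zero (hvdm _ (neg_ne_zero.mpr hN0)) (ne_of_gt ?_)
    exact integral_exp_pos (integrable_of_continuous_of_compactSpace
      (continuous_orbitWeight B fun i => -N * a i))
  have hformula : (fun z : ℂ => (D₀ : ℂ) * ((∏ p ∈ pairs N, (-(z * N) * (a p.2 - a p.1 : ℂ))) *
      hciz μ A B z)) = fun z : ℂ =>
      (Matrix.of fun i j => Complex.exp (-(z * N) * (a i : ℂ) * b j)).det * (K : ℂ) := by
    have hd := differentiable_hciz (μ := μ) B hA hB ha
    refine eq_of_eq_ofReal (by fun_prop) ?_ fun x => ?_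
    · simp only [det_apply', of_apply]
      fun_prop
    · have h := vdm_mul_integral_orbitWeight (μ := μ) hB hb.injective hbe
        (fun i => -(x * N) * a i) (fun i => -N * a i) hD₀_ne
      have hx : ((vdm fun i => -(x * N) * a i : ℝ) : ℂ) =
          ∏ p ∈ pairs N, (-((x : ℂ) * N) * (a p.2 - a p.1 : ℂ)) := by
        rw [vdm, Complex.ofReal_prod]
        refine Finset.prod_congr rfl fun p _ => ?_
        push_cast
        ring
      have hE := ofReal_det_exp (-(x * N)) a b
      push_cast at hE
      rw [hciz_ofReal B hA hB ha x, ← hx, ← hE, ← Complex.ofReal_mul, ← Complex.ofReal_mul,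
        ← Complex.ofReal_mul]
      exact congrArg Complex.ofReal h
  intro z
  rcases eq_or_ne z 0 with rfl | hz
  · refine iff_of_false (by simp [hciz]) ?_
    rintro ⟨i, j, hij, k, hk, h⟩
    have hk' : (k : ℝ) ≠ 0 := by exact_mod_cast hk
    refine mul_ne_zero (Complex.ofReal_ne_zero.mpr ?_) Complex.I_ne_zero h.symm
    exact div_ne_zero (mul_ne_zero (mul_ne_zero two_ne_zero hk') Real.pi_ne_zero)
      (mul_ne_zero (mul_ne_zero hN0 hℏ.ne') (sub_ne_zero.mpr (hb hij).ne'))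
  · have hz' := congrFun hformula z
    have hvz : ∏ p ∈ pairs N, (-(z * N) * (a p.2 - a p.1 : ℂ)) ≠ 0 := by
      refine Finset.prod_ne_zero_iff.mpr fun p hp => ?_
      refine mul_ne_zero (neg_ne_zero.mpr (mul_ne_zero hz (by exact_mod_cast hN0))) ?_
      rw [sub_ne_zero]
      exact fun h => (Finset.mem_filter.mp hp).2.ne (ha_inj (by exact_mod_cast h.symm))
    have h1 : hciz μ A B z = 0 ↔
        (Matrix.of fun i j => Complex.exp (-(z * N) * (a i : ℂ) * b j)).det = 0 := by
      have hDc : (D₀ : ℂ) ≠ 0 := by exact_mod_cast hD₀_ne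
      have hKc : (K : ℂ) ≠ 0 := by exact_mod_cast hK_ne
      constructor
      · intro h
        rw [h, mul_zero, mul_zero] at hz'
        exact (mul_eq_zero.mp hz'.symm).resolve_right hKc
      · intro h
        rw [h, zero_mul] at hz'
        exact ((mul_eq_zero.mp hz').resolve_left hDc |> mul_eq_zero.mp).resolve_left hvz
    rw [h1, det_exp_arithmetic_eq_zero_iff a₁ ℏ b (-(z * N))]
    refine exists_congr fun i => exists_congr fun j => and_congr_right fun hij => ?_
    have hbij : (b j : ℂ) - b i ≠ 0 := by
      rw [sub_ne_zero]
      exact_mod_cast (hb hij).ne'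
    have hNc : (N : ℂ) ≠ 0 := by exact_mod_cast hN0
    have hℏc : (ℏ : ℂ) ≠ 0 := by exact_mod_cast hℏ.ne'
    constructor
    · rintro ⟨k, hk⟩
      have hzk : z = ((2 * (k : ℝ) * Real.pi / (N * ℏ * (b j - b i)) : ℝ) : ℂ) * Complex.I := by
        push_cast
        field_simp
        linear_combination hk
      refine ⟨k, ?_, hzk⟩
      rintro rfl
      exact hz (by rw [hzk]; simp)
    · rintro ⟨k, -, hk⟩
      refine ⟨k, ?_⟩
      rw [hk]
      push_cast
      field_simp
      ring

end HCIZ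
end

section
/- Let N ≥ 1 and let A, B be N×N normal complex matrices. For every integer d with 1 ≤ d ≤ N, ∫_{U(N)} (Tr(A U B U⁻¹))^d dκ_N(U) = N^{−d} Σ_{α,β⊢d} p_α(A) p_β(B) Σ_{r=0}^∞ (−1/N)^r H̃^r(α,β), where the inner series converges absolutely. -/
open MeasureTheory Matrix

namespace HCIZ

section TensorPower

variable {d N : ℕ}

/-- The tensor product `M 0 ⊗ M 1 ⊗ ⋯` as a matrix indexed by multi-indices. -/
def tensor (M : Fin d → Matrix (Fin N) (Fin N) ℂ) :
    Matrix (Fin d → Fin N) (Fin d → Fin N) ℂ :=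
  of fun i j => ∏ k, M k (i k) (j k)

lemma tensor_apply (M : Fin d → Matrix (Fin N) (Fin N) ℂ) (i j : Fin d → Fin N) :
    tensor M i j = ∏ k, M k (i k) (j k) := rfl

lemma tensor_mul (M M' : Fin d → Matrix (Fin N) (Fin N) ℂ) :
    tensor M * tensor M' = tensor fun k => M k * M' k := by
  ext i j
  simp only [mul_apply, tensor_apply, ← Finset.prod_mul_distrib]
  rw [Finset.prod_univ_sum, Fintype.piFinset_univ]

lemma tensor_one : tensor (fun _ : Fin d => (1 : Matrix (Fin N) (Fin N) ℂ)) = 1 := by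
  ext i j
  simp only [tensor_apply, one_apply]
  rw [Finset.prod_ite_zero]
  simp [funext_iff]

/-- The matrix `X` acting on the `k`-th tensor factor. -/
def slot (k : Fin d) (X : Matrix (Fin N) (Fin N) ℂ) :
    Matrix (Fin d → Fin N) (Fin d → Fin N) ℂ :=
  tensor (Function.update (fun _ => 1) k X)

lemma slot_apply (k : Fin d) (X : Matrix (Fin N) (Fin N) ℂ) (i j : Fin d → Fin N) :
    slot k X i j = if j = Function.update i k (j k) then X (i k) (j k) else 0 := by
  rw [slot, tensor_apply, ← Finset.mul_prod_erase _ _ (Finset.mem_univ k)]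
  have : ∏ l ∈ Finset.univ.erase k,
      Function.update (fun _ => (1 : Matrix (Fin N) (Fin N) ℂ)) k X l (i l) (j l)
      = ∏ l ∈ Finset.univ.erase k, if i l = j l then (1 : ℂ) else 0 := by
    refine Finset.prod_congr rfl fun l hl => ?_
    rw [Function.update_of_ne (Finset.ne_of_mem_erase hl), one_apply]
  rw [this, Finset.prod_ite_zero, Function.update_self]
  have h : (j = Function.update i k (j k)) ↔ ∀ l ∈ Finset.univ.erase k, i l = j l := by
    rw [Function.eq_update_iff]
    simp [eq_comm]
  simp only [h]
  split_ifs <;> simp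

lemma slot_mul_apply (k : Fin d) (X : Matrix (Fin N) (Fin N) ℂ)
    (Y : Matrix (Fin d → Fin N) (Fin d → Fin N) ℂ) (i j : Fin d → Fin N) :
    (slot k X * Y) i j = ∑ c, X (i k) c * Y (Function.update i k c) j := by
  rw [mul_apply]
  symm
  refine Finset.sum_of_injOn (fun c => Function.update i k c) ?_ ?_ ?_ ?_
  · intro a _ b _ h
    simpa using congrFun h k
  · simp
  · intro l _ hl
    rw [slot_apply, if_neg, zero_mul]
    exact fun h => hl ⟨l k, by simp, h.symm⟩
  · intro c _
    simp [slot_apply]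

lemma mul_slot_apply (k : Fin d) (X : Matrix (Fin N) (Fin N) ℂ)
    (Y : Matrix (Fin d → Fin N) (Fin d → Fin N) ℂ) (i j : Fin d → Fin N) :
    (Y * slot k X) i j = ∑ c, Y i (Function.update j k c) * X c (j k) := by
  rw [mul_apply]
  symm
  refine Finset.sum_of_injOn (fun c => Function.update j k c) ?_ ?_ ?_ ?_
  · intro a _ b _ h
    simpa using congrFun h k
  · simp
  · intro l _ hl
    rw [slot_apply, if_neg, mul_zero]
    refine fun h => hl ⟨l k, by simp, ?_⟩
    change Function.update j k (l k) = l
    rw [h]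
    simp
  · intro c _
    simp [slot_apply]

/-- The permutation `σ` acting on tensor factors. -/
def permMat (N : ℕ) (σ : Equiv.Perm (Fin d)) : Matrix (Fin d → Fin N) (Fin d → Fin N) ℂ :=
  of fun i j => if i ∘ σ = j then 1 else 0

lemma permMat_apply (σ : Equiv.Perm (Fin d)) (i j : Fin d → Fin N) :
    permMat N σ i j = if i ∘ σ = j then 1 else 0 := rfl

lemma permMat_mul_apply (σ : Equiv.Perm (Fin d))
    (Y : Matrix (Fin d → Fin N) (Fin d → Fin N) ℂ) (i j : Fin d → Fin N) :
    (permMat N σ * Y) i j = Y (i ∘ σ) j := by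
  simp [mul_apply, permMat_apply]

lemma comp_perm_eq_iff (σ : Equiv.Perm (Fin d)) (i j : Fin d → Fin N) :
    i ∘ σ = j ↔ i = j ∘ ⇑σ⁻¹ := by
  constructor
  · rintro rfl
    ext x
    simp
  · rintro rfl
    ext x
    simp

lemma mul_permMat_apply (σ : Equiv.Perm (Fin d))
    (Y : Matrix (Fin d → Fin N) (Fin d → Fin N) ℂ) (i j : Fin d → Fin N) :
    (Y * permMat N σ) i j = Y i (j ∘ ⇑σ⁻¹) := by
  simp [mul_apply, permMat_apply, comp_perm_eq_iff]

lemma permMat_mul (σ τ : Equiv.Perm (Fin d)) :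
    permMat N (σ * τ) = permMat N σ * permMat N τ := by
  ext i j
  rw [permMat_mul_apply, permMat_apply, permMat_apply]
  rfl

lemma permMat_one : permMat N (1 : Equiv.Perm (Fin d)) = 1 := by
  ext i j
  simp [permMat_apply, one_apply]

lemma permMat_mul_tensor (σ : Equiv.Perm (Fin d)) (M : Fin d → Matrix (Fin N) (Fin N) ℂ) :
    permMat N σ * tensor M = tensor (fun k => M (σ⁻¹ k)) * permMat N σ := by
  ext i j
  rw [permMat_mul_apply, mul_permMat_apply, tensor_apply, tensor_apply]
  exact Fintype.prod_equiv σ _ _ fun k => by simp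

lemma permMat_mul_slot (σ : Equiv.Perm (Fin d)) (k : Fin d) (X : Matrix (Fin N) (Fin N) ℂ) :
    permMat N σ * slot k X = slot (σ k) X * permMat N σ := by
  rw [slot, permMat_mul_tensor, slot]
  congr 2
  ext1 l
  by_cases h : l = σ k
  · subst h; simp
  · rw [Function.update_of_ne h, Function.update_of_ne]
    rintro rfl
    simp at h

lemma sum_slot_single_mul_slot_single {k l : Fin d} (hkl : k ≠ l) :
    ∑ a, ∑ b, slot k (single b a (1 : ℂ)) * slot l (single a b (1 : ℂ))
      = permMat N (Equiv.swap k l) := by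
  ext i j
  simp only [Matrix.sum_apply, slot_mul_apply, slot_apply, permMat_apply, single_apply]
  rw [Finset.sum_eq_single (i l), Finset.sum_eq_single (i k), Finset.sum_eq_single (i l)]
  · have h : (i ∘ Equiv.swap k l = j) ↔
        (j = Function.update (Function.update i k (i l)) l (j l) ∧ i k = j l) := by
      rw [Function.eq_update_iff, funext_iff]
      constructor
      · intro h
        have h1 : ∀ x, x ≠ l → j x = Function.update i k (i l) x := by
          intro x hx
          rw [← h x]
          by_cases hxk : x = k
          · subst hxk; simp
          · simp [Function.update_of_ne hxk, Equiv.swap_apply_of_ne_of_ne hxk hx]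
        refine ⟨⟨rfl, fun x hx => h1 x hx⟩, ?_⟩
        rw [← h l]; simp
      · rintro ⟨⟨-, h1⟩, h2⟩ x
        by_cases hx : x = l
        · subst hx; simpa using h2
        · rw [h1 x hx]
          by_cases hxk : x = k
          · subst hxk; simp
          · simp [Function.update_of_ne hxk, Equiv.swap_apply_of_ne_of_ne hxk hx]
    simp only [h, Function.update_of_ne hkl.symm]
    simp only [true_and, and_self, if_true, one_mul, ite_and]
  · intro c _ hc
    simp [hc.symm]
  · simp
  · intro b _ hb
    simp [hb]
  · simp
  · intro a _ ha
    refine Finset.sum_eq_zero fun b _ => Finset.sum_eq_zero fun c _ => ?_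
    simp [Function.update_of_ne hkl.symm, ha]
  · simp

lemma sum_slot_single_mul_self (k : Fin d) :
    ∑ a, ∑ b, slot k (single b a (1 : ℂ)) * slot k (single a b (1 : ℂ))
      = (N : ℂ) • (1 : Matrix (Fin d → Fin N) (Fin d → Fin N) ℂ) := by
  have h : ∀ a b : Fin N, slot k (single b a (1 : ℂ)) * slot k (single a b (1 : ℂ))
      = slot k (single b b (1 : ℂ)) := by
    intro a b
    rw [slot, slot, tensor_mul, slot]
    congr 1
    ext1 l
    by_cases hl : l = k
    · subst hl; simp
    · simp [Function.update_of_ne hl]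
  simp only [h, Finset.sum_const, Finset.card_univ, Fintype.card_fin, ← Nat.cast_smul_eq_nsmul ℂ]
  congr 1
  ext i j
  simp only [Matrix.sum_apply, slot_apply, single_apply, one_apply]
  by_cases hij : i = j
  · subst hij; simp
  · rw [if_neg hij]
    refine Finset.sum_eq_zero fun b _ => ?_
    by_cases h1 : j = Function.update i k (j k)
    · rw [if_pos h1, if_neg]
      rintro ⟨h2, h3⟩
      apply hij
      rw [h1, ← h3, h2]
      simp
    · rw [if_neg h1]

end TensorPower

section PartialTrace

variable {d N : ℕ}

lemma slot_add (k : Fin d) (X Y : Matrix (Fin N) (Fin N) ℂ) :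
    slot k (X + Y) = slot k X + slot k Y := by
  ext i j
  simp only [slot_apply, Matrix.add_apply]
  split_ifs <;> simp

lemma slot_smul (k : Fin d) (c : ℂ) (X : Matrix (Fin N) (Fin N) ℂ) :
    slot k (c • X) = c • slot k X := by
  ext i j
  simp only [slot_apply, Matrix.smul_apply]
  split_ifs <;> simp

/-- The partial trace over the `m`-th tensor factor, tensored with the identity there. -/
def partialTrace (N : ℕ) (m : Fin d) :
    Matrix (Fin d → Fin N) (Fin d → Fin N) ℂ →ₗ[ℂ] Matrix (Fin d → Fin N) (Fin d → Fin N) ℂ where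
  toFun X := ∑ a, ∑ b, slot m (single b a 1) * X * slot m (single a b 1)
  map_add' X Y := by simp only [mul_add, add_mul, Finset.sum_add_distrib]
  map_smul' c X := by simp [Finset.smul_sum]

lemma partialTrace_def (m : Fin d) (X : Matrix (Fin d → Fin N) (Fin d → Fin N) ℂ) :
    partialTrace N m X = ∑ a, ∑ b, slot m (single b a 1) * X * slot m (single a b 1) := rfl

lemma partialTrace_apply (m : Fin d) (X : Matrix (Fin d → Fin N) (Fin d → Fin N) ℂ)
    (i j : Fin d → Fin N) :
    partialTrace N m X i j = if i m = j m then
      ∑ a, X (Function.update i m a) (Function.update j m a) else 0 := by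
  have h : ∀ a b, (slot m (single b a 1) * X * slot m (single a b 1)) i j
      = if i m = b then if j m = b then X (Function.update i m a) (Function.update j m a)
        else 0 else 0 := by
    intro a b
    rw [mul_slot_apply, Finset.sum_eq_single a, slot_mul_apply, Finset.sum_eq_single a]
    · simp only [single_apply, and_true, true_and, eq_comm (a := b)]
      split_ifs <;> simp
    · intro c _ hc
      simp [hc.symm]
    · simp
    · intro c _ hc
      simp [hc.symm]
    · simp
  simp only [partialTrace_def, Matrix.sum_apply, h]
  simp only [Finset.sum_ite_eq, Finset.mem_univ, if_true]
  split_ifs with h1 h2 h2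
  · rfl
  · exact absurd h1.symm h2
  · exact absurd h2.symm h1
  · simp

lemma partialTrace_mul_left {m : Fin d} {Y : Matrix (Fin d → Fin N) (Fin d → Fin N) ℂ}
    (hY : ∀ X, Commute Y (slot m X)) (X : Matrix (Fin d → Fin N) (Fin d → Fin N) ℂ) :
    partialTrace N m (Y * X) = Y * partialTrace N m X := by
  simp only [partialTrace_def, Finset.mul_sum]
  refine Finset.sum_congr rfl fun a _ => Finset.sum_congr rfl fun b _ => ?_
  rw [← mul_assoc, ← mul_assoc, ← mul_assoc, (hY _).eq]

lemma partialTrace_mul_right {m : Fin d} {Y : Matrix (Fin d → Fin N) (Fin d → Fin N) ℂ}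
    (hY : ∀ X, Commute Y (slot m X)) (X : Matrix (Fin d → Fin N) (Fin d → Fin N) ℂ) :
    partialTrace N m (X * Y) = partialTrace N m X * Y := by
  simp only [partialTrace_def, Finset.sum_mul]
  refine Finset.sum_congr rfl fun a _ => Finset.sum_congr rfl fun b _ => ?_
  rw [mul_assoc, mul_assoc, (hY _).eq, ← mul_assoc, ← mul_assoc]

lemma partialTrace_slot_conj (m : Fin d) {U V : Matrix (Fin N) (Fin N) ℂ} (h : V * U = 1)
    (X : Matrix (Fin d → Fin N) (Fin d → Fin N) ℂ) :
    partialTrace N m (slot m U * X * slot m V) = partialTrace N m X := by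
  ext i j
  rw [partialTrace_apply, partialTrace_apply]
  congr 1
  simp only [mul_slot_apply, slot_mul_apply, Function.update_self, Function.update_idem,
    Finset.sum_mul]
  calc ∑ a, ∑ c', ∑ c, U a c * X (Function.update i m c) (Function.update j m c') * V c' a
      = ∑ c', ∑ c, (V * U) c' c * X (Function.update i m c) (Function.update j m c') := by
        rw [Finset.sum_comm]
        refine Finset.sum_congr rfl fun c' _ => ?_
        rw [Finset.sum_comm]
        refine Finset.sum_congr rfl fun c _ => ?_
        rw [mul_apply, Finset.sum_mul]
        exact Finset.sum_congr rfl fun a _ => by ring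
    _ = _ := by simp [h, one_apply]

/-- The tensor product of `m` copies of `U` in the first factors and the identity elsewhere. -/
def tensorPow (d m : ℕ) (U : Matrix (Fin N) (Fin N) ℂ) :
    Matrix (Fin d → Fin N) (Fin d → Fin N) ℂ :=
  tensor fun k => if k.val < m then U else 1

lemma tensorPow_mul (m : ℕ) (U V : Matrix (Fin N) (Fin N) ℂ) :
    tensorPow d m (U * V) = tensorPow d m U * tensorPow d m V := by
  rw [tensorPow, tensorPow, tensorPow, tensor_mul]
  congr 1
  ext1 k
  split_ifs <;> simp

lemma tensorPow_zero (U : Matrix (Fin N) (Fin N) ℂ) : tensorPow d 0 U = 1 := by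
  simp [tensorPow, tensor_one]

lemma tensorPow_succ (m : Fin d) (U : Matrix (Fin N) (Fin N) ℂ) :
    tensorPow d (m + 1) U = tensorPow d m U * slot m U := by
  rw [tensorPow, tensorPow, slot, tensor_mul]
  congr 1
  ext1 k
  rcases lt_trichotomy k m with h | h | h
  · rw [Function.update_of_ne h.ne, if_pos (by omega), if_pos (by omega), mul_one]
  · subst h; simp
  · rw [Function.update_of_ne h.ne', if_neg (by omega), if_neg (by omega), mul_one]

lemma tensorPow_commute_slot (m : Fin d) (U X : Matrix (Fin N) (Fin N) ℂ) :
    Commute (tensorPow d m U) (slot m X) := by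
  rw [Commute, SemiconjBy, tensorPow, slot, tensor_mul, tensor_mul]
  congr 1
  ext1 k
  by_cases h : k = m
  · subst h; simp
  · simp [Function.update_of_ne h]

lemma permMat_commute_tensorPow {m : ℕ} {σ : Equiv.Perm (Fin d)}
    (hσ : ∀ k : Fin d, m ≤ k → σ k = k) (U : Matrix (Fin N) (Fin N) ℂ) :
    Commute (permMat N σ) (tensorPow d m U) := by
  rw [Commute, SemiconjBy, tensorPow, permMat_mul_tensor]
  congr 2
  ext1 k
  have hσ' : ∀ k : Fin d, m ≤ k → σ⁻¹ k = k := fun k hk => by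
    rw [Equiv.Perm.inv_eq_iff_eq, hσ k hk]
  congr 1
  by_cases hk : m ≤ k
  · rw [hσ' k hk]
  · have : ¬ m ≤ (σ⁻¹ k : Fin d) := by
      intro h
      have h2 := hσ _ h
      rw [← Equiv.Perm.mul_apply, mul_inv_cancel, Equiv.Perm.one_apply] at h2
      rw [← h2] at h
      exact hk h
    apply propext
    constructor <;> intro <;> omega

lemma permMat_commute_slot {m : Fin d} {σ : Equiv.Perm (Fin d)} (hσ : σ m = m)
    (X : Matrix (Fin N) (Fin N) ℂ) : Commute (permMat N σ) (slot m X) := by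
  rw [Commute, SemiconjBy, permMat_mul_slot, hσ]

lemma partialTrace_tensorPow_conj (m : Fin d) {U V : Matrix (Fin N) (Fin N) ℂ} (h : V * U = 1)
    (X : Matrix (Fin d → Fin N) (Fin d → Fin N) ℂ) :
    partialTrace N m (tensorPow d (m + 1) U * X * tensorPow d (m + 1) V)
      = tensorPow d m U * partialTrace N m X * tensorPow d m V := by
  rw [tensorPow_succ, tensorPow_succ, (tensorPow_commute_slot m V V).eq]
  rw [show tensorPow d m U * slot m U * X * (slot m V * tensorPow d m V)
    = tensorPow d m U * (slot m U * X * slot m V) * tensorPow d m V by simp only [mul_assoc]]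
  rw [partialTrace_mul_right (fun X => tensorPow_commute_slot m V X),
    partialTrace_mul_left (fun X => tensorPow_commute_slot m U X), partialTrace_slot_conj m h]

/-- The Jucys–Murphy element `∑_{k < m} (k m)` acting on tensors. -/
def jucysMurphy (N : ℕ) (m : Fin d) : Matrix (Fin d → Fin N) (Fin d → Fin N) ℂ :=
  ∑ k ∈ Finset.Iio m, permMat N (Equiv.swap k m)

lemma permMat_swap_mul_self (k l : Fin d) :
    permMat N (Equiv.swap k l) * permMat N (Equiv.swap k l) = 1 := by
  rw [← permMat_mul, Equiv.swap_mul_self, permMat_one]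

/-- If `E` is invariant under the infinitesimal action of `GL(N)` on the first `m + 1` factors,
multiplication by `N + J_m` reduces it to partial traces over the last of these factors. -/
lemma mul_natCast_add_jucysMurphy (m : Fin d)
    (E : Matrix (Fin d → Fin N) (Fin d → Fin N) ℂ)
    (hE : ∀ X, Commute (∑ k ∈ Finset.Iic m, slot k X) E) :
    E * ((N : ℂ) • 1 + jucysMurphy N m) = ∑ k ∈ Finset.Iic m,
      permMat N (Equiv.swap k m) * partialTrace N m (permMat N (Equiv.swap k m) * E) := by
  have h1 : (N : ℂ) • 1 + jucysMurphy N m = ∑ k ∈ Finset.Iic m,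
      ∑ a, ∑ b, slot k (single b a (1 : ℂ)) * slot m (single a b (1 : ℂ)) := by
    rw [← Finset.Iio_insert, Finset.sum_insert (by simp), sum_slot_single_mul_self, jucysMurphy]
    congr 1
    refine Finset.sum_congr rfl fun k hk => ?_
    rw [sum_slot_single_mul_slot_single (Finset.mem_Iio.1 hk).ne]
  have h2 : E * ((N : ℂ) • 1 + jucysMurphy N m) = ∑ a, ∑ b,
      (∑ k ∈ Finset.Iic m, slot k (single b a (1 : ℂ))) * E * slot m (single a b (1 : ℂ)) := by
    rw [h1, Finset.sum_comm, Finset.mul_sum]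
    refine Finset.sum_congr rfl fun a _ => ?_
    rw [Finset.sum_comm, Finset.mul_sum]
    refine Finset.sum_congr rfl fun b _ => ?_
    rw [(hE _).eq, mul_assoc, Finset.sum_mul]
  rw [h2]
  simp only [Finset.sum_mul, partialTrace_def, Finset.mul_sum]
  rw [Finset.sum_congr rfl fun a _ => Finset.sum_comm, Finset.sum_comm]
  refine Finset.sum_congr rfl fun k _ => Finset.sum_congr rfl fun a _ =>
    Finset.sum_congr rfl fun b _ => ?_
  have h3 := permMat_mul_slot (Equiv.swap k m) m (single b a (1 : ℂ))
  rw [Equiv.swap_apply_right] at h3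
  simp only [← mul_assoc]
  rw [h3, mul_assoc (slot k _) (permMat N _), permMat_swap_mul_self, mul_one]

end PartialTrace

section Twirl

variable {d N : ℕ}

lemma compactSpace_unitaryGroup (N : ℕ) : CompactSpace (unitaryGroup (Fin N) ℂ) := by
  have hc : IsCompact (Set.univ.pi fun _ : Fin N => Set.univ.pi fun _ : Fin N =>
      Metric.closedBall (0 : ℂ) 1) :=
    isCompact_univ_pi fun _ => isCompact_univ_pi fun _ => isCompact_closedBall 0 1
  have hclosed : IsClosed (unitaryGroup (Fin N) ℂ : Set (Matrix (Fin N) (Fin N) ℂ)) :=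
    isClosed_unitary
  refine isCompact_iff_compactSpace.1 (hc.of_isClosed_subset hclosed ?_)
  intro U hU i _ j _
  simpa using entry_norm_bound_of_unitary hU i j

/-- The entrywise integral of a matrix-valued function. -/
noncomputable def matInt {ι : Type*} (μ : Measure (unitaryGroup (Fin N) ℂ))
    (F : unitaryGroup (Fin N) ℂ → Matrix ι ι ℂ) : Matrix ι ι ℂ :=
  of fun i j => ∫ U, F U i j ∂μ

lemma integrable_of_continuous (μ : Measure (unitaryGroup (Fin N) ℂ)) [IsFiniteMeasure μ]
    {f : unitaryGroup (Fin N) ℂ → ℂ} (hf : Continuous f) : Integrable f μ := by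
  have := compactSpace_unitaryGroup N
  exact hf.integrable_of_hasCompactSupport (HasCompactSupport.of_compactSpace f)

lemma linearMap_matInt {ι : Type*} [Fintype ι] [DecidableEq ι]
    (μ : Measure (unitaryGroup (Fin N) ℂ)) [IsFiniteMeasure μ]
    {F : unitaryGroup (Fin N) ℂ → Matrix ι ι ℂ} (hF : Continuous F)
    (φ : Matrix ι ι ℂ →ₗ[ℂ] ℂ) : φ (matInt μ F) = ∫ U, φ (F U) ∂μ := by
  have h : ∀ X : Matrix ι ι ℂ, φ X = ∑ i, ∑ j, X i j * φ (single i j 1) := by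
    intro X
    conv_lhs => rw [matrix_eq_sum_single X]
    simp only [map_sum]
    refine Finset.sum_congr rfl fun i _ => Finset.sum_congr rfl fun j _ => ?_
    rw [← smul_eq_mul, ← map_smul, smul_single, smul_eq_mul, mul_one]
  have hij : ∀ i j, Integrable (fun U => F U i j * φ (single i j 1)) μ := fun i j =>
    (integrable_of_continuous μ (hF.matrix_elem i j)).mul_const _
  rw [h]
  simp only [h (F _)]
  rw [integral_finsetSum _ fun i _ => integrable_finsetSum _ fun j _ => hij i j]
  refine Finset.sum_congr rfl fun i _ => ?_
  rw [integral_finsetSum _ fun j _ => hij i j]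
  refine Finset.sum_congr rfl fun j _ => ?_
  rw [integral_mul_const]
  rfl

lemma linearMap_matInt' {ι : Type*} [Fintype ι] [DecidableEq ι]
    (μ : Measure (unitaryGroup (Fin N) ℂ)) [IsFiniteMeasure μ]
    {F : unitaryGroup (Fin N) ℂ → Matrix ι ι ℂ} (hF : Continuous F)
    (Φ : Matrix ι ι ℂ →ₗ[ℂ] Matrix ι ι ℂ) :
    Φ (matInt μ F) = matInt μ fun U => Φ (F U) := by
  ext i j
  exact linearMap_matInt μ hF (entryLinearMap ℂ ℂ i j ∘ₗ Φ)

lemma matInt_const {ι : Type*} (μ : Measure (unitaryGroup (Fin N) ℂ)) [IsProbabilityMeasure μ]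
    (X : Matrix ι ι ℂ) : matInt μ (fun _ => X) = X := by
  ext i j
  simp [matInt]

lemma continuous_tensorPow (d m : ℕ) :
    Continuous fun U : Matrix (Fin N) (Fin N) ℂ => tensorPow d m U := by
  refine continuous_matrix fun i j => ?_
  simp only [tensorPow, tensor_apply]
  refine continuous_finsetProd _ fun k _ => ?_
  split_ifs
  · exact continuous_id.matrix_elem _ _
  · exact continuous_const

/-- The average of `U^{⊗m} B U^{-⊗m}` over the unitary group. -/
noncomputable def twirl (μ : Measure (unitaryGroup (Fin N) ℂ)) (m : ℕ)
    (B : Matrix (Fin d → Fin N) (Fin d → Fin N) ℂ) :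
    Matrix (Fin d → Fin N) (Fin d → Fin N) ℂ :=
  matInt μ fun U => tensorPow d m (U : Matrix (Fin N) (Fin N) ℂ) * B *
    tensorPow d m ((U⁻¹ : unitaryGroup (Fin N) ℂ) : Matrix (Fin N) (Fin N) ℂ)

lemma continuous_conj_tensorPow (m : ℕ) (B : Matrix (Fin d → Fin N) (Fin d → Fin N) ℂ) :
    Continuous fun U : unitaryGroup (Fin N) ℂ =>
      tensorPow d m (U : Matrix (Fin N) (Fin N) ℂ) * B *
        tensorPow d m ((U⁻¹ : unitaryGroup (Fin N) ℂ) : Matrix (Fin N) (Fin N) ℂ) := by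
  have h1 : Continuous fun U : unitaryGroup (Fin N) ℂ => (U : Matrix (Fin N) (Fin N) ℂ) :=
    continuous_subtype_val
  have h2 : Continuous fun U : unitaryGroup (Fin N) ℂ =>
      ((U⁻¹ : unitaryGroup (Fin N) ℂ) : Matrix (Fin N) (Fin N) ℂ) := h1.star
  exact (((continuous_tensorPow d m).comp h1).mul continuous_const).mul
    ((continuous_tensorPow d m).comp h2)

variable (μ : Measure (unitaryGroup (Fin N) ℂ)) [IsProbabilityMeasure μ]

lemma mul_twirl {m : ℕ} {Y : Matrix (Fin d → Fin N) (Fin d → Fin N) ℂ}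
    (hY : ∀ U, Commute Y (tensorPow d m U)) (B : Matrix (Fin d → Fin N) (Fin d → Fin N) ℂ) :
    Y * twirl μ m B = twirl μ m (Y * B) := by
  have h := linearMap_matInt' μ (continuous_conj_tensorPow m B) (LinearMap.mulLeft ℂ Y)
  simp only [LinearMap.mulLeft_apply] at h
  rw [twirl, h, twirl]
  congr 1
  ext1 U
  rw [← mul_assoc, ← mul_assoc, (hY _).eq, mul_assoc (tensorPow d m _)]

lemma partialTrace_twirl (m : Fin d) (B : Matrix (Fin d → Fin N) (Fin d → Fin N) ℂ) :
    partialTrace N m (twirl μ (m + 1) B) = twirl μ m (partialTrace N m B) := by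
  rw [twirl, linearMap_matInt' μ (continuous_conj_tensorPow _ B), twirl]
  congr 1
  ext1 U
  refine partialTrace_tensorPow_conj m ?_ B
  exact congrArg Subtype.val (inv_mul_cancel U)

lemma twirl_zero (B : Matrix (Fin d → Fin N) (Fin d → Fin N) ℂ) : twirl μ 0 B = B := by
  simp only [twirl, tensorPow_zero, one_mul, mul_one]
  exact matInt_const μ B

variable [μ.IsHaarMeasure]

lemma tensorPow_commute_twirl (m : ℕ) (B : Matrix (Fin d → Fin N) (Fin d → Fin N) ℂ)
    (V : unitaryGroup (Fin N) ℂ) :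
    Commute (tensorPow d m (V : Matrix (Fin N) (Fin N) ℂ)) (twirl μ m B) := by
  have h1 := linearMap_matInt' μ (continuous_conj_tensorPow m B)
    (LinearMap.mulLeft ℂ (tensorPow d m (V : Matrix (Fin N) (Fin N) ℂ)))
  have h2 := linearMap_matInt' μ (continuous_conj_tensorPow m B)
    (LinearMap.mulRight ℂ (tensorPow d m (V : Matrix (Fin N) (Fin N) ℂ)))
  simp only [LinearMap.mulLeft_apply, LinearMap.mulRight_apply] at h1 h2
  rw [Commute, SemiconjBy, twirl, h1, h2]
  ext i j
  simp only [matInt, of_apply]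
  rw [← integral_mul_left_eq_self (fun U : unitaryGroup (Fin N) ℂ =>
    (tensorPow d m (U : Matrix (Fin N) (Fin N) ℂ) * B *
    tensorPow d m ((U⁻¹ : unitaryGroup (Fin N) ℂ) : Matrix (Fin N) (Fin N) ℂ) *
    tensorPow d m (V : Matrix (Fin N) (Fin N) ℂ)) i j) V]
  congr 1
  ext1 U
  have h3 : tensorPow d m (((V * U)⁻¹ : unitaryGroup (Fin N) ℂ) : Matrix (Fin N) (Fin N) ℂ) *
      tensorPow d m (V : Matrix (Fin N) (Fin N) ℂ)
      = tensorPow d m ((U⁻¹ : unitaryGroup (Fin N) ℂ) : Matrix (Fin N) (Fin N) ℂ) := by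
    rw [← tensorPow_mul]
    congr 1
    exact congrArg Subtype.val (show (V * U)⁻¹ * V = U⁻¹ by group)
  rw [mul_assoc _ (tensorPow d m _) (tensorPow d m (V : Matrix (Fin N) (Fin N) ℂ)), h3]
  rw [show ((V * U : unitaryGroup (Fin N) ℂ) : Matrix (Fin N) (Fin N) ℂ)
    = (V : Matrix (Fin N) (Fin N) ℂ) * U from rfl, tensorPow_mul]
  simp only [mul_assoc]

section Exponential

open scoped Matrix.Norms.Operator

lemma hasDerivAt_exp_entry (X : Matrix (Fin N) (Fin N) ℂ) (i j : Fin N) :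
    HasDerivAt (fun t : ℝ => NormedSpace.exp (t • X) i j) (X i j) 0 := by
  have h := hasDerivAt_exp_smul_const (𝕂 := ℝ) X 0
  rw [zero_smul, NormedSpace.exp_zero, one_mul] at h
  exact hasDerivAt_pi.1 (hasDerivAt_pi.1 h i) j

lemma exp_mem_unitaryGroup {X : Matrix (Fin N) (Fin N) ℂ} (hX : Xᴴ = -X) (t : ℝ) :
    NormedSpace.exp (t • X) ∈ unitaryGroup (Fin N) ℂ := by
  rw [mem_unitaryGroup_iff, star_eq_conjTranspose, ← exp_conjTranspose, conjTranspose_smul, hX,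
    star_trivial, smul_neg, ← Matrix.exp_add_of_commute _ _ (Commute.refl (t • X)).neg_right,
    add_neg_cancel, NormedSpace.exp_zero]

end Exponential

lemma hasDerivAt_tensorPow_exp (m : Fin d) (X : Matrix (Fin N) (Fin N) ℂ)
    (i j : Fin d → Fin N) :
    HasDerivAt (fun t : ℝ => tensorPow d (m + 1) (NormedSpace.exp (t • X)) i j)
      ((∑ k ∈ Finset.Iic m, slot k X) i j) 0 := by
  simp only [tensorPow, tensor_apply]
  have h : ∀ k ∈ (Finset.univ : Finset (Fin d)), HasDerivAt
      (fun t : ℝ => (if k.val < m + 1 then NormedSpace.exp (t • X) else 1 :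
        Matrix (Fin N) (Fin N) ℂ) (i k) (j k)) (if k ≤ m then X (i k) (j k) else 0) 0 := by
    intro k _
    by_cases hk : k ≤ m
    · simp only [if_pos hk, if_pos (show k.val < m + 1 by omega)]
      exact hasDerivAt_exp_entry X _ _
    · simp only [if_neg hk, if_neg (show ¬ k.val < m + 1 by omega)]
      exact hasDerivAt_const _ _
  refine (HasDerivAt.fun_finsetProd h).congr_deriv ?_
  rw [Matrix.sum_apply, ← Finset.sum_filter_add_sum_filter_not Finset.univ (fun k => k ≤ m)]
  rw [Finset.sum_eq_zero (s := Finset.univ.filter fun k => ¬ k ≤ m), add_zero]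
  · refine Finset.sum_congr (by ext; simp) fun k hk => ?_
    rw [if_pos (Finset.mem_Iic.1 hk), smul_eq_mul, slot, tensor_apply,
      ← Finset.prod_erase_mul _ _ (Finset.mem_univ k), Function.update_self]
    congr 1
    refine Finset.prod_congr rfl fun l hl => ?_
    rw [Function.update_of_ne (Finset.ne_of_mem_erase hl), zero_smul, NormedSpace.exp_zero,
      ite_self]
  · intro k hk
    rw [if_neg (Finset.mem_filter.1 hk).2, smul_zero]

lemma sum_slot_commute_twirl_of_skew (m : Fin d)
    (B : Matrix (Fin d → Fin N) (Fin d → Fin N) ℂ)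
    {X : Matrix (Fin N) (Fin N) ℂ} (hX : Xᴴ = -X) :
    Commute (∑ k ∈ Finset.Iic m, slot k X) (twirl μ (m + 1) B) := by
  ext i j
  have h1 : HasDerivAt (fun t : ℝ =>
      (tensorPow d (m + 1) (NormedSpace.exp (t • X)) * twirl μ (m + 1) B) i j)
      (((∑ k ∈ Finset.Iic m, slot k X) * twirl μ (m + 1) B) i j) 0 := by
    simp only [mul_apply]
    exact HasDerivAt.fun_sum fun l _ => (hasDerivAt_tensorPow_exp m X i l).mul_const _
  have h2 : HasDerivAt (fun t : ℝ =>
      (twirl μ (m + 1) B * tensorPow d (m + 1) (NormedSpace.exp (t • X))) i j)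
      ((twirl μ (m + 1) B * (∑ k ∈ Finset.Iic m, slot k X)) i j) 0 := by
    simp only [mul_apply]
    exact HasDerivAt.fun_sum fun l _ => (hasDerivAt_tensorPow_exp m X l j).const_mul _
  have h3 : (fun t : ℝ =>
      (tensorPow d (m + 1) (NormedSpace.exp (t • X)) * twirl μ (m + 1) B) i j)
      = fun t : ℝ =>
      (twirl μ (m + 1) B * tensorPow d (m + 1) (NormedSpace.exp (t • X))) i j := by
    ext1 t
    rw [(tensorPow_commute_twirl μ (m + 1) B ⟨_, exp_mem_unitaryGroup hX t⟩).eq]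
  rw [h3] at h1
  exact h1.unique h2

lemma sum_slot_commute_twirl (m : Fin d) (B : Matrix (Fin d → Fin N) (Fin d → Fin N) ℂ)
    (X : Matrix (Fin N) (Fin N) ℂ) :
    Commute (∑ k ∈ Finset.Iic m, slot k X) (twirl μ (m + 1) B) := by
  have h1 : (X - Xᴴ)ᴴ = -(X - Xᴴ) := by simp
  have h2 : (Complex.I • (X + Xᴴ))ᴴ = -(Complex.I • (X + Xᴴ)) := by
    simp [conjTranspose_smul, add_comm]
  have h3 : X = (1 / 2 : ℂ) • (X - Xᴴ) + (-Complex.I / 2) • (Complex.I • (X + Xᴴ)) := by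
    rw [smul_smul, show -Complex.I / 2 * Complex.I = 1 / 2 by
      rw [div_mul_eq_mul_div, neg_mul, Complex.I_mul_I, neg_neg], ← smul_add,
      show X - Xᴴ + (X + Xᴴ) = (2 : ℂ) • X by rw [two_smul]; abel, smul_smul]
    norm_num
  have h4 : ∑ k ∈ Finset.Iic m, slot k X
      = (1 / 2 : ℂ) • (∑ k ∈ Finset.Iic m, slot k (X - Xᴴ))
        + (-Complex.I / 2) • (∑ k ∈ Finset.Iic m, slot k (Complex.I • (X + Xᴴ))) := by
    conv_lhs => rw [h3]
    simp only [slot_add, slot_smul _ (1 / 2 : ℂ), slot_smul _ (-Complex.I / 2),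
      Finset.sum_add_distrib, Finset.smul_sum]
  rw [h4]
  exact ((sum_slot_commute_twirl_of_skew μ m B h1).smul_left _).add_left
    ((sum_slot_commute_twirl_of_skew μ m B h2).smul_left _)

/-- The recursion for averages over the unitary group. -/
lemma twirl_succ_mul (m : Fin d) (B : Matrix (Fin d → Fin N) (Fin d → Fin N) ℂ) :
    twirl μ (m + 1) B * ((N : ℂ) • 1 + jucysMurphy N m) = ∑ k ∈ Finset.Iic m,
      permMat N (Equiv.swap k m) *
        twirl μ m (partialTrace N m (permMat N (Equiv.swap k m) * B)) := by
  rw [mul_natCast_add_jucysMurphy m _ (sum_slot_commute_twirl μ m B)]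
  refine Finset.sum_congr rfl fun k hk => ?_
  rw [mul_twirl μ (fun U => permMat_commute_tensorPow ?_ U), partialTrace_twirl]
  intro l hl
  have hk := Finset.mem_Iic.1 hk
  exact Equiv.swap_apply_of_ne_of_ne (by omega) (by omega)

end Twirl

section Unfolding

variable {d N : ℕ}

/-- The permutations of `Fin d` fixing every `k ≥ m`. -/
def permsBelow (d m : ℕ) : Finset (Equiv.Perm (Fin d)) :=
  Finset.univ.filter fun σ => ∀ k : Fin d, m ≤ k.val → σ k = k

lemma mem_permsBelow {m : ℕ} {σ : Equiv.Perm (Fin d)} :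
    σ ∈ permsBelow d m ↔ ∀ k : Fin d, m ≤ k.val → σ k = k := by
  simp [permsBelow]

lemma permsBelow_zero : permsBelow d 0 = {1} := by
  ext σ
  simp [mem_permsBelow, Equiv.ext_iff]

lemma permsBelow_self : permsBelow d d = Finset.univ := by
  ext σ
  simp only [mem_permsBelow, Finset.mem_univ, iff_true]
  intro k hk
  omega

lemma sum_permsBelow_succ {M : Type*} [AddCommMonoid M] (m : Fin d)
    (f : Equiv.Perm (Fin d) → M) :
    ∑ σ ∈ permsBelow d (m + 1), f σ
      = ∑ k ∈ Finset.Iic m, ∑ σ ∈ permsBelow d m, f (σ * Equiv.swap k m) := by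
  rw [← Finset.sum_product']
  symm
  refine Finset.sum_nbij' (fun x => x.2 * Equiv.swap x.1 m)
    (fun σ => (σ⁻¹ m, σ * Equiv.swap (σ⁻¹ m) m)) ?_ ?_ ?_ ?_ ?_
  · rintro ⟨k, σ⟩ h
    simp only [Finset.mem_product, Finset.mem_Iic, mem_permsBelow] at h ⊢
    intro l hl
    rw [Equiv.Perm.mul_apply, Equiv.swap_apply_of_ne_of_ne (by omega) (by omega),
      h.2 l (by omega)]
  · intro σ h
    simp only [Finset.mem_product, Finset.mem_Iic, mem_permsBelow] at h ⊢
    have hle : σ⁻¹ m ≤ m := by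
      by_contra hlt
      have h1 := h (σ⁻¹ m) (by omega)
      rw [← Equiv.Perm.mul_apply, mul_inv_cancel, Equiv.Perm.one_apply] at h1
      rw [← h1] at hlt
      exact hlt le_rfl
    refine ⟨hle, fun l hl => ?_⟩
    rw [Equiv.Perm.mul_apply]
    by_cases hlm : l = m
    · subst hlm
      rw [Equiv.swap_apply_right, ← Equiv.Perm.mul_apply, mul_inv_cancel, Equiv.Perm.one_apply]
    · have hlt : m < l := lt_of_le_of_ne hl (Ne.symm hlm)
      rw [Equiv.swap_apply_of_ne_of_ne (hle.trans_lt hlt).ne' hlm, h l (by omega)]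
  · rintro ⟨k, σ⟩ h
    simp only [Finset.mem_product, Finset.mem_Iic, mem_permsBelow] at h
    have h1 : (σ * Equiv.swap k m)⁻¹ m = k := by
      rw [Equiv.Perm.inv_eq_iff_eq, Equiv.Perm.mul_apply, Equiv.swap_apply_left, h.2 m le_rfl]
    simp only [h1, mul_assoc, Equiv.swap_mul_self, mul_one]
  · intro σ _
    simp only [mul_assoc, Equiv.swap_mul_self, mul_one]
  · intro x _
    rfl

/-- The product `(N + J_{m-1}) ⋯ (N + J_0)` acting on tensors. -/
def jucysProd (d N : ℕ) : ℕ → Matrix (Fin d → Fin N) (Fin d → Fin N) ℂ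
  | 0 => 1
  | m + 1 => (if h : m < d then (N : ℂ) • 1 + jucysMurphy N ⟨m, h⟩ else 1) * jucysProd d N m

/-- The composition of the partial traces over the first `m` tensor factors. -/
def partialTraces (d N : ℕ) : ℕ →
    (Matrix (Fin d → Fin N) (Fin d → Fin N) ℂ →ₗ[ℂ] Matrix (Fin d → Fin N) (Fin d → Fin N) ℂ)
  | 0 => LinearMap.id
  | m + 1 => partialTraces d N m ∘ₗ
      (if h : m < d then partialTrace N ⟨m, h⟩ else LinearMap.id)

lemma partialTrace_tensor (m : Fin d) (M : Fin d → Matrix (Fin N) (Fin N) ℂ) :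
    partialTrace N m (tensor M) = (M m).trace • tensor (Function.update M m 1) := by
  ext i j
  rw [partialTrace_apply, Matrix.smul_apply, tensor_apply,
    ← Finset.mul_prod_erase _ _ (Finset.mem_univ m), Function.update_self, one_apply]
  have h1 : ∏ k ∈ Finset.univ.erase m, Function.update M m 1 k (i k) (j k)
      = ∏ k ∈ Finset.univ.erase m, M k (i k) (j k) :=
    Finset.prod_congr rfl fun k hk => by rw [Function.update_of_ne (Finset.ne_of_mem_erase hk)]
  have h2 : ∀ a, tensor M (Function.update i m a) (Function.update j m a)
      = M m a a * ∏ k ∈ Finset.univ.erase m, M k (i k) (j k) := by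
    intro a
    rw [tensor_apply, ← Finset.mul_prod_erase _ _ (Finset.mem_univ m), Function.update_self,
      Function.update_self]
    congr 1
    refine Finset.prod_congr rfl fun k hk => ?_
    rw [Function.update_of_ne (Finset.ne_of_mem_erase hk),
      Function.update_of_ne (Finset.ne_of_mem_erase hk)]
  simp only [h1, h2, ← Finset.sum_mul, trace, diag_apply]
  split_ifs <;> simp

lemma partialTraces_tensor (m : ℕ) (M : Fin d → Matrix (Fin N) (Fin N) ℂ) :
    partialTraces d N m (tensor M) = (∏ k, if k.val < m then (M k).trace else 1) •
      tensor fun k => if k.val < m then 1 else M k := by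
  induction m generalizing M with
  | zero => simp [partialTraces]
  | succ m ih =>
    rw [partialTraces, LinearMap.comp_apply]
    by_cases h : m < d
    · rw [dif_pos h, partialTrace_tensor, map_smul, ih, smul_smul]
      congr 1
      · rw [← Finset.mul_prod_erase _ _ (Finset.mem_univ (⟨m, h⟩ : Fin d)),
          ← Finset.mul_prod_erase _ _ (Finset.mem_univ (⟨m, h⟩ : Fin d))]
        simp only [lt_irrefl, if_false, one_mul, lt_add_one, if_true]
        congr 1
        refine Finset.prod_congr rfl fun k hk => ?_
        have hk' : k.val ≠ m := fun hk' => Finset.ne_of_mem_erase hk (Fin.ext hk')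
        rw [Function.update_of_ne (Finset.ne_of_mem_erase hk)]
        exact if_congr (by omega) rfl rfl
      · congr 1
        ext1 k
        by_cases hk : k = ⟨m, h⟩
        · subst hk; simp
        · have hk' : k.val ≠ m := fun hk' => hk (Fin.ext hk')
          rw [Function.update_of_ne hk]
          exact if_congr (by omega) rfl rfl
    · rw [dif_neg h, LinearMap.id_apply, ih]
      have h' : ∀ k : Fin d, k.val < m ↔ k.val < m + 1 := fun k => by omega
      simp only [h']

lemma partialTraces_self (X : Matrix (Fin d → Fin N) (Fin d → Fin N) ℂ) :
    partialTraces d N d X = X.trace • 1 := by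
  have h : ∀ i j : Fin d → Fin N, single i j (1 : ℂ) = tensor fun k => single (i k) (j k) 1 := by
    intro i j
    ext i' j'
    simp only [tensor_apply, single_apply]
    rw [Finset.prod_ite_zero]
    simp [funext_iff, forall_and]
  have h1 : ∀ i j : Fin d → Fin N, partialTraces d N d (single i j 1)
      = (single i j (1 : ℂ)).trace • 1 := by
    intro i j
    rw [h, partialTraces_tensor]
    simp only [Fin.is_lt, if_true, tensor_one]
    congr 1
    simp only [trace, diag_apply, tensor_apply]
    rw [Finset.prod_univ_sum, Fintype.piFinset_univ]
  have h2 : ∀ i j : Fin d → Fin N, single i j (X i j) = X i j • single i j (1 : ℂ) := by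
    intro i j
    rw [smul_single, smul_eq_mul, mul_one]
  rw [matrix_eq_sum_single X]
  simp only [h2, map_sum, map_smul, h1, trace_sum, trace_smul, Finset.sum_smul, smul_assoc]

lemma partialTrace_permMat_mul {m : Fin d} {σ : Equiv.Perm (Fin d)} (hσ : σ m = m)
    (X : Matrix (Fin d → Fin N) (Fin d → Fin N) ℂ) :
    partialTrace N m (permMat N σ * X) = permMat N σ * partialTrace N m X :=
  partialTrace_mul_left (fun Y => permMat_commute_slot hσ Y) X

variable (μ : Measure (unitaryGroup (Fin N) ℂ)) [IsProbabilityMeasure μ] [μ.IsHaarMeasure]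

lemma twirl_mul_jucysProd (m : ℕ) (hm : m ≤ d)
    (B : Matrix (Fin d → Fin N) (Fin d → Fin N) ℂ) :
    twirl μ m B * jucysProd d N m = ∑ σ ∈ permsBelow d m,
      permMat N σ⁻¹ * partialTraces d N m (permMat N σ * B) := by
  induction m generalizing B with
  | zero =>
    simp [twirl_zero, jucysProd, permsBelow_zero, partialTraces, permMat_one]
  | succ m ih =>
    have hmd : m < d := hm
    rw [jucysProd, dif_pos hmd, ← mul_assoc]
    have h := twirl_succ_mul μ (⟨m, hmd⟩ : Fin d) B
    simp only at h
    rw [h, Finset.sum_mul, sum_permsBelow_succ (⟨m, hmd⟩ : Fin d)]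
    refine Finset.sum_congr rfl fun k _ => ?_
    rw [mul_assoc, ih (by omega), Finset.mul_sum]
    refine Finset.sum_congr rfl fun σ hσ => ?_
    rw [_root_.mul_inv_rev, Equiv.swap_inv, permMat_mul, permMat_mul, mul_assoc, partialTraces,
      LinearMap.comp_apply, dif_pos hmd, mul_assoc (permMat N σ),
      partialTrace_permMat_mul (mem_permsBelow.1 hσ _ le_rfl)]

lemma twirl_mul_jucysProd_self (B : Matrix (Fin d → Fin N) (Fin d → Fin N) ℂ) :
    twirl μ d B * jucysProd d N d
      = ∑ σ : Equiv.Perm (Fin d), (permMat N σ * B).trace • permMat N σ⁻¹ := by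
  rw [twirl_mul_jucysProd μ d le_rfl, permsBelow_self]
  refine Finset.sum_congr rfl fun σ _ => ?_
  rw [partialTraces_self, mul_smul_comm, mul_one]

end Unfolding

section MonotoneTuples

variable {d N : ℕ}

open Classical in
/-- The monotone tuples of `r` transpositions supported on the indices below `m`. -/
noncomputable def monoTuples (d m r : ℕ) : Finset (Fin r → Equiv.Perm (Fin d)) :=
  Finset.univ.filter fun τ => IsMonotoneTuple τ ∧ ∀ i, ∀ x ∈ (τ i).support, x.val < m

lemma mem_monoTuples {m r : ℕ} {τ : Fin r → Equiv.Perm (Fin d)} :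
    τ ∈ monoTuples d m r ↔ IsMonotoneTuple τ ∧ ∀ i, ∀ x ∈ (τ i).support, x.val < m := by
  simp [monoTuples]

lemma mem_monoTuples_self {r : ℕ} {τ : Fin r → Equiv.Perm (Fin d)} :
    τ ∈ monoTuples d d r ↔ IsMonotoneTuple τ := by
  simp [mem_monoTuples]

lemma monoTuples_length_zero (m : ℕ) : monoTuples d m 0 = {Fin.elim0} := by
  ext τ
  simp only [mem_monoTuples, Finset.mem_singleton, IsMonotoneTuple]
  exact ⟨fun _ => Subsingleton.elim _ _,
    fun _ => ⟨⟨fun i => i.elim0, fun i => i.elim0⟩, fun i => i.elim0⟩⟩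

lemma monoTuples_zero_succ (r : ℕ) : monoTuples d 0 (r + 1) = ∅ := by
  ext τ
  simp only [mem_monoTuples, Finset.notMem_empty, iff_false]
  rintro ⟨⟨h1, -⟩, h2⟩
  obtain ⟨x, y, hxy, hτ⟩ := h1 0
  have : x ∈ (τ 0).support := by simp [hτ, Ne.symm hxy]
  exact absurd (h2 0 x this) (by omega)

lemma eq_swap_of_isSwap_of_mem_support {σ : Equiv.Perm (Fin d)} (hσ : σ.IsSwap) {m : Fin d}
    (hm : m ∈ σ.support) : σ = Equiv.swap (σ m) m := by
  obtain ⟨x, y, hxy, rfl⟩ := hσ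
  rw [Equiv.Perm.support_swap hxy, Finset.mem_insert, Finset.mem_singleton] at hm
  rcases hm with rfl | rfl
  · rw [Equiv.swap_apply_left, Equiv.swap_comm]
  · rw [Equiv.swap_apply_right]

lemma max_support_swap {k m : Fin d} (h : k < m) :
    (Equiv.swap k m).support.max = (m : WithBot (Fin d)) := by
  rw [Equiv.Perm.support_swap h.ne, Finset.max_insert, Finset.max_singleton]
  exact max_eq_right (WithBot.coe_le_coe.2 h.le)

lemma snoc_mem_monoTuples {m : Fin d} {r : ℕ} {τ : Fin r → Equiv.Perm (Fin d)}
    (hτ : τ ∈ monoTuples d (m + 1) r) {k : Fin d} (hk : k < m) :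
    (Fin.snoc τ (Equiv.swap k m) : Fin (r + 1) → Equiv.Perm (Fin d))
      ∈ monoTuples d (m + 1) (r + 1) := by
  rw [mem_monoTuples] at hτ ⊢
  obtain ⟨⟨h1, h2⟩, h3⟩ := hτ
  refine ⟨⟨fun i => ?_, fun i j hij => ?_⟩, fun i x hx => ?_⟩
  · refine Fin.lastCases ?_ (fun i => ?_) i
    · rw [Fin.snoc_last]
      exact ⟨k, m, hk.ne, rfl⟩
    · rw [Fin.snoc_castSucc]
      exact h1 i
  · revert hij
    refine Fin.lastCases ?_ (fun j => ?_) j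
    · refine Fin.lastCases ?_ (fun i => ?_) i
      · exact fun _ => le_rfl
      · intro _
        simp only [Fin.snoc_last, Fin.snoc_castSucc, max_support_swap hk]
        refine Finset.max_le fun a ha => WithBot.coe_le_coe.2 ?_
        have := h3 i a ha
        exact Fin.le_def.2 (by omega)
    · refine Fin.lastCases ?_ (fun i => ?_) i
      · intro h
        exact absurd h (not_le.2 (Fin.castSucc_lt_last j))
      · intro h
        simp only [Fin.snoc_castSucc]
        exact h2 (Fin.castSucc_le_castSucc_iff.1 h)
  · revert hx
    refine Fin.lastCases ?_ (fun i => ?_) i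
    · rw [Fin.snoc_last, Equiv.Perm.support_swap hk.ne, Finset.mem_insert, Finset.mem_singleton]
      rintro (rfl | rfl) <;> omega
    · rw [Fin.snoc_castSucc]
      exact h3 i x

lemma init_mem_monoTuples {m r : ℕ} {τ : Fin (r + 1) → Equiv.Perm (Fin d)}
    (hτ : τ ∈ monoTuples d m (r + 1)) :
    (fun i => τ (Fin.castSucc i)) ∈ monoTuples d m r := by
  rw [mem_monoTuples] at hτ ⊢
  exact ⟨⟨fun i => hτ.1.1 _, fun i j hij => hτ.1.2 (Fin.castSucc_le_castSucc_iff.2 hij)⟩,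
    fun i => hτ.2 _⟩

lemma mem_support_last {m : Fin d} {r : ℕ} {τ : Fin (r + 1) → Equiv.Perm (Fin d)}
    (hτ : τ ∈ monoTuples d (m + 1) (r + 1)) (hτ' : τ ∉ monoTuples d m (r + 1)) :
    m ∈ (τ (Fin.last r)).support := by
  rw [mem_monoTuples] at hτ hτ'
  obtain ⟨h1, h2⟩ := hτ
  have h3 : ¬ ∀ i, ∀ x ∈ (τ i).support, x.val < m := fun h => hτ' ⟨h1, h⟩
  push Not at h3
  obtain ⟨i, x, hx, hmx⟩ := h3
  have hxm : x = m := Fin.ext (by have := h2 i x hx; omega)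
  subst hxm
  have h4 : (x : WithBot (Fin d)) ≤ (τ (Fin.last r)).support.max :=
    (Finset.le_max hx).trans (h1.2 (Fin.le_last i))
  obtain ⟨y, hy⟩ := Finset.max_of_nonempty (s := (τ (Fin.last r)).support) (by
    rw [Finset.nonempty_iff_ne_empty]
    intro h
    rw [h, Finset.max_empty] at h4
    exact absurd h4 (not_le.2 (WithBot.bot_lt_coe x)))
  have hy' := Finset.mem_of_max hy
  rw [hy, WithBot.coe_le_coe] at h4
  have h5 := h2 _ y hy'
  have : y = x := le_antisymm (Fin.le_def.2 (by omega)) h4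
  rwa [this] at hy'

lemma prod_ofFn_snoc {r : ℕ} (τ : Fin r → Equiv.Perm (Fin d)) (σ : Equiv.Perm (Fin d)) :
    (List.ofFn (Fin.snoc τ σ : Fin (r + 1) → Equiv.Perm (Fin d))).prod
      = (List.ofFn τ).prod * σ := by
  rw [List.ofFn_succ', List.concat_eq_append, List.prod_append]
  simp

lemma sum_monoTuples_succ_succ {M : Type*} [AddCommMonoid M] (m : Fin d) (r : ℕ)
    (f : Equiv.Perm (Fin d) → M) :
    ∑ τ ∈ monoTuples d (m + 1) (r + 1), f (List.ofFn τ).prod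
      = ∑ τ ∈ monoTuples d m (r + 1), f (List.ofFn τ).prod
        + ∑ τ ∈ monoTuples d (m + 1) r, ∑ k ∈ Finset.Iio m,
            f ((List.ofFn τ).prod * Equiv.swap k m) := by
  classical
  rw [← Finset.sum_filter_add_sum_filter_not _ (fun τ => τ ∈ monoTuples d m (r + 1))]
  congr 1
  · refine Finset.sum_congr ?_ fun _ _ => rfl
    ext τ
    simp only [Finset.mem_filter, and_iff_right_iff_imp]
    intro h
    rw [mem_monoTuples] at h ⊢
    exact ⟨h.1, fun i x hx => (h.2 i x hx).trans (Nat.lt_succ_self _)⟩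
  · rw [← Finset.sum_product']
    symm
    refine Finset.sum_nbij' (fun x => Fin.snoc x.1 (Equiv.swap x.2 m))
      (fun τ => (fun i => τ (Fin.castSucc i), τ (Fin.last r) m)) ?_ ?_ ?_ ?_ ?_
    · rintro ⟨τ, k⟩ h
      rw [Finset.mem_product, Finset.mem_Iio] at h
      refine Finset.mem_filter.2 ⟨snoc_mem_monoTuples h.1 h.2, fun h' => ?_⟩
      have h3 := (mem_monoTuples.1 h').2 (Fin.last r) m
      rw [Fin.snoc_last, Equiv.Perm.support_swap h.2.ne] at h3
      exact lt_irrefl _ (h3 (by simp))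
    · intro τ h
      rw [Finset.mem_filter] at h
      rw [Finset.mem_product, Finset.mem_Iio]
      refine ⟨init_mem_monoTuples h.1, ?_⟩
      have h1 := mem_support_last h.1 h.2
      have h2 := (mem_monoTuples.1 h.1).2 (Fin.last r) (τ (Fin.last r) m)
        (Equiv.Perm.apply_mem_support.2 h1)
      have h3 : τ (Fin.last r) m ≤ m := Fin.le_def.2 (by omega)
      exact lt_of_le_of_ne h3 (Equiv.Perm.mem_support.1 h1)
    · rintro ⟨τ, k⟩ _
      simp
    · intro τ h
      rw [Finset.mem_filter] at h
      have h1 := mem_support_last h.1 h.2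
      have h2 := eq_swap_of_isSwap_of_mem_support ((mem_monoTuples.1 h.1).1.1 (Fin.last r)) h1
      ext1 i
      refine Fin.lastCases ?_ (fun i => ?_) i
      · simp [← h2]
      · simp
    · rintro ⟨τ, k⟩ _
      simp only [prod_ofFn_snoc]

lemma card_monoTuples_succ_succ (m : Fin d) (r : ℕ) :
    (monoTuples d (m + 1) (r + 1)).card
      = (monoTuples d m (r + 1)).card + m * (monoTuples d (m + 1) r).card := by
  have h := sum_monoTuples_succ_succ m r fun _ => 1
  simpa [mul_comm] using h

lemma summable_card_monoTuples {m : ℕ} (hm : m ≤ d) {x : ℝ} (hx : 0 ≤ x) (hdx : m * x < 1 + x) :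
    Summable fun r => x ^ r * ((monoTuples d m r).card : ℝ) := by
  induction m with
  | zero =>
    refine summable_of_ne_finset_zero (s := {0}) fun r hr => ?_
    obtain ⟨r, rfl⟩ := Nat.exists_eq_succ_of_ne_zero (by simpa using hr)
    simp [monoTuples_zero_succ]
  | succ m ih =>
    push_cast at hdx
    have hmx : m * x < 1 := by linarith
    have ih := ih (by omega) (by linarith)
    have hnn : ∀ (m r : ℕ), 0 ≤ x ^ r * ((monoTuples d m r).card : ℝ) := fun m r => by positivity
    refine summable_of_sum_range_le (c := (∑' r, x ^ r * ((monoTuples d m r).card : ℝ)) /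
      (1 - m * x)) (hnn _) fun n => ?_
    rw [le_div_iff₀ (by linarith)]
    have h1 : ∑ r ∈ Finset.range n, x ^ r * ((monoTuples d (m + 1) r).card : ℝ)
        ≤ ∑ r ∈ Finset.range (n + 1), x ^ r * ((monoTuples d (m + 1) r).card : ℝ) := by
      rw [Finset.sum_range_succ]
      linarith [hnn (m + 1) n]
    have h2 : ∑ r ∈ Finset.range (n + 1), x ^ r * ((monoTuples d (m + 1) r).card : ℝ)
        = ∑ r ∈ Finset.range (n + 1), x ^ r * ((monoTuples d m r).card : ℝ)
          + m * x * ∑ r ∈ Finset.range n, x ^ r * ((monoTuples d (m + 1) r).card : ℝ) := by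
      have hr : ∀ r, ((monoTuples d (m + 1) (r + 1)).card : ℝ)
          = (monoTuples d m (r + 1)).card + m * (monoTuples d (m + 1) r).card := fun r => by
        exact_mod_cast card_monoTuples_succ_succ (⟨m, hm⟩ : Fin d) r
      rw [Finset.sum_range_succ', Finset.sum_range_succ' _ n]
      have e : ∀ (r : ℕ) (c : ℝ), x ^ (r + 1) * (m * c) = m * x * (x ^ r * c) :=
        fun r c => by ring
      simp only [hr, monoTuples_length_zero, mul_add, Finset.sum_add_distrib, Finset.mul_sum, e]
      rw [add_right_comm]
    have h3 := ih.sum_le_tsum (Finset.range (n + 1)) fun r _ => hnn m r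
    linarith

/-- The sum over monotone tuples of the product, acting on tensors. -/
noncomputable def monoSum (d N m r : ℕ) : Matrix (Fin d → Fin N) (Fin d → Fin N) ℂ :=
  ∑ τ ∈ monoTuples d m r, permMat N (List.ofFn τ).prod

lemma monoSum_length_zero (m : ℕ) : monoSum d N m 0 = 1 := by
  simp [monoSum, monoTuples_length_zero, permMat_one]

lemma monoSum_succ_succ (m : Fin d) (r : ℕ) :
    monoSum d N (m + 1) (r + 1)
      = monoSum d N m (r + 1) + monoSum d N (m + 1) r * jucysMurphy N m := by
  rw [monoSum, sum_monoTuples_succ_succ, monoSum, monoSum, jucysMurphy, Finset.sum_mul_sum]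
  simp only [permMat_mul]

lemma norm_monoSum_apply_le (m r : ℕ) (i j : Fin d → Fin N) :
    ‖monoSum d N m r i j‖ ≤ (monoTuples d m r).card := by
  rw [monoSum, Matrix.sum_apply]
  refine (norm_sum_le _ _).trans ?_
  rw [Finset.cast_card]
  refine Finset.sum_le_sum fun τ _ => ?_
  rw [permMat_apply]
  split_ifs <;> simp

lemma norm_neg_one_div (N : ℕ) : ‖-(1 : ℂ) / N‖ = 1 / N := by
  simp

lemma natCast_mul_inv_lt {m : ℕ} (hmN : m ≤ N) : (m : ℝ) * (1 / N) < 1 + 1 / N := by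
  rcases Nat.eq_zero_or_pos N with rfl | hN
  · simp
  · have hN' : (0 : ℝ) < N := by exact_mod_cast hN
    have h1 : (m : ℝ) ≤ N := by exact_mod_cast hmN
    have h2 : (m : ℝ) * (1 / N) ≤ 1 := by rwa [mul_one_div, div_le_one hN']
    have h3 : 0 < 1 / (N : ℝ) := by positivity
    linarith

lemma summable_monoSum {m : ℕ} (hm : m ≤ d) (hmN : m ≤ N) :
    Summable fun r => (-(1 : ℂ) / N) ^ r • monoSum d N m r := by
  refine Pi.summable.2 fun i => Pi.summable.2 fun j => ?_
  refine Summable.of_norm_bounded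
    (summable_card_monoTuples hm (by positivity) (natCast_mul_inv_lt hmN)) fun r => ?_
  rw [Matrix.smul_apply, norm_smul, norm_pow, norm_neg_one_div]
  exact mul_le_mul_of_nonneg_left (norm_monoSum_apply_le m r i j) (by positivity)

lemma tsum_monoSum_mul {m : Fin d} (hmN : m.val + 1 ≤ N) :
    (∑' r, (-(1 : ℂ) / N) ^ r • monoSum d N (m + 1) r) * ((N : ℂ) • 1 + jucysMurphy N m)
      = (N : ℂ) • ∑' r, (-(1 : ℂ) / N) ^ r • monoSum d N m r := by
  have hN : (N : ℂ) ≠ 0 := by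
    rw [Nat.cast_ne_zero]
    omega
  have hs := summable_monoSum (d := d) (N := N) (m := m + 1) (by omega) hmN
  have hs' := summable_monoSum (d := d) (N := N) (m := m) (by omega) (by omega)
  have h1 : ∑' r, (-(1 : ℂ) / N) ^ (r + 1) • monoSum d N (m + 1) (r + 1)
      = ∑' r, (-(1 : ℂ) / N) ^ (r + 1) • monoSum d N m (r + 1)
        + (∑' r, (-(1 : ℂ) / N) ^ r • monoSum d N (m + 1) r) *
            ((-(1 : ℂ) / N) • jucysMurphy N m) := by
    rw [← hs.tsum_mul_right, ← Summable.tsum_add ((summable_nat_add_iff 1).2 hs')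
      (hs.mul_right _)]
    congr 1
    ext1 r
    rw [monoSum_succ_succ, smul_add, smul_mul_smul_comm, pow_succ]
  have h2 := hs.tsum_eq_zero_add
  have h3 := hs'.tsum_eq_zero_add
  rw [h1] at h2
  rw [pow_zero, one_smul, monoSum_length_zero] at h2 h3
  rw [← add_assoc, ← h3] at h2
  have h4 : (N : ℂ) • (1 : Matrix (Fin d → Fin N) (Fin d → Fin N) ℂ) + jucysMurphy N m
      = (N : ℂ) • (1 - (-(1 : ℂ) / N) • jucysMurphy N m) := by
    rw [smul_sub, smul_smul, mul_div_cancel₀ _ hN, neg_smul, one_smul, sub_neg_eq_add]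
  rw [h4, mul_smul_comm, mul_sub, mul_one]
  congr 1
  rw [sub_eq_iff_eq_add]
  exact h2

lemma tsum_monoSum_mul_jucysProd {m : ℕ} (hm : m ≤ d) (hmN : m ≤ N) :
    (∑' r, (-(1 : ℂ) / N) ^ r • monoSum d N m r) * jucysProd d N m = (N : ℂ) ^ m • 1 := by
  induction m with
  | zero =>
    rw [tsum_eq_single 0]
    · simp [monoSum_length_zero, jucysProd]
    · intro r hr
      obtain ⟨r, rfl⟩ := Nat.exists_eq_succ_of_ne_zero hr
      simp [monoSum, monoTuples_zero_succ]
  | succ m ih =>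
    have hmd : m < d := hm
    have h := tsum_monoSum_mul (d := d) (N := N) (m := ⟨m, hmd⟩) hmN
    simp only at h
    rw [jucysProd, dif_pos hmd, ← mul_assoc, h, smul_mul_assoc, ih (by omega) (by omega),
      smul_smul, pow_succ']

lemma jucysProd_mul_tsum_monoSum (hd : d ≤ N) (hN : N ≠ 0) :
    jucysProd d N d * (∑' r, (-(1 : ℂ) / N) ^ r • monoSum d N d r) = (N : ℂ) ^ d • 1 := by
  have hN' : (N : ℂ) ^ d ≠ 0 := pow_ne_zero _ (Nat.cast_ne_zero.2 hN)
  have h := tsum_monoSum_mul_jucysProd (d := d) (N := N) le_rfl hd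
  have h1 : (((N : ℂ) ^ d)⁻¹ • ∑' r, (-(1 : ℂ) / N) ^ r • monoSum d N d r) * jucysProd d N d
      = 1 := by
    rw [smul_mul_assoc, h, smul_smul, inv_mul_cancel₀ hN', one_smul]
  have h2 := mul_eq_one_comm.1 h1
  rw [mul_smul_comm] at h2
  rw [← h2, smul_smul, mul_inv_cancel₀ hN', one_smul]

end MonotoneTuples

section CycleTrace

variable {n : Type*} [Fintype n]

/-- The sum over all labellings `i` of the product of the entries `A (i (σ a)) (i a)`. -/
def cycleSum {α : Type*} [Fintype α] [DecidableEq α] (A : Matrix n n ℂ) (σ : Equiv.Perm α) : ℂ :=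
  ∑ i : α → n, ∏ a, A (i (σ a)) (i a)

lemma cycleSum_conj {α β : Type*} [Fintype α] [DecidableEq α] [Fintype β] [DecidableEq β]
    (A : Matrix n n ℂ) {σ : Equiv.Perm α} {τ : Equiv.Perm β} (e : β ≃ α)
    (h : ∀ b, e (τ b) = σ (e b)) : cycleSum A σ = cycleSum A τ := by
  refine Fintype.sum_equiv (e.symm.arrowCongr (Equiv.refl n)) _ _ fun i => ?_
  rw [← e.prod_comp]
  simp [h]

lemma sum_prod_path [DecidableEq n] (A : Matrix n n ℂ) (m : ℕ) (g : n → n → ℂ) :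
    ∑ i : Fin (m + 1) → n, (∏ k : Fin m, A (i k.succ) (i k.castSucc)) * g (i (Fin.last m)) (i 0)
      = ∑ x, ∑ y, (A ^ m) x y * g x y := by
  induction m generalizing g with
  | zero =>
    rw [← (Equiv.funUnique (Fin 1) n).symm.sum_comp]
    simp [one_apply]
  | succ m ih =>
    rw [← (Fin.consEquiv fun _ => n).sum_comp, Fintype.sum_prod_type, Finset.sum_comm]
    have h : ∀ (j : Fin (m + 1) → n), ∑ y, (∏ k : Fin (m + 1),
        A ((Fin.consEquiv fun _ => n) (y, j) k.succ)
          ((Fin.consEquiv fun _ => n) (y, j) k.castSucc)) *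
        g ((Fin.consEquiv fun _ => n) (y, j) (Fin.last (m + 1)))
          ((Fin.consEquiv fun _ => n) (y, j) 0)
        = (∏ k : Fin m, A (j k.succ) (j k.castSucc)) *
          ∑ y, A (j 0) y * g (j (Fin.last m)) y := by
      intro j
      rw [Finset.mul_sum]
      refine Finset.sum_congr rfl fun y _ => ?_
      simp only [Fin.consEquiv_apply, Fin.cons_succ, Fin.cons_zero, ← Fin.succ_last]
      rw [Fin.prod_univ_succ]
      simp only [Fin.castSucc_zero, Fin.cons_zero, ← Fin.succ_castSucc, Fin.cons_succ]
      ring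
    rw [Finset.sum_congr rfl fun j _ => h j, ih fun x z => ∑ y, A z y * g x y]
    refine Finset.sum_congr rfl fun x _ => ?_
    simp only [pow_succ, mul_apply, Finset.sum_mul, Finset.mul_sum, ← mul_assoc]
    rw [Finset.sum_comm]

lemma cycleSum_finRotate [DecidableEq n] (A : Matrix n n ℂ) (m : ℕ) :
    cycleSum A (finRotate (m + 1)) = (A ^ (m + 1)).trace := by
  have h := sum_prod_path A m fun x y => A y x
  simp only [trace, diag, pow_succ, mul_apply]
  rw [← h]
  refine Finset.sum_congr rfl fun i _ => ?_
  rw [Fin.prod_univ_castSucc]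
  simp

lemma cycleSum_of_isCycleOn [DecidableEq n] {α : Type*} [Fintype α] [DecidableEq α] [Nonempty α]
    (A : Matrix n n ℂ) {σ : Equiv.Perm α} (hσ : σ.IsCycleOn (Finset.univ : Finset α)) :
    cycleSum A σ = (A ^ Fintype.card α).trace := by
  obtain ⟨b⟩ := ‹Nonempty α›
  obtain ⟨m, hm⟩ := Nat.exists_eq_succ_of_ne_zero (Fintype.card_ne_zero (α := α))
  have hbij : Function.Bijective fun k : Fin (m + 1) => (σ ^ (k : ℕ)) b := by
    rw [Fintype.bijective_iff_surjective_and_card]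
    refine ⟨fun a => ?_, by simp [hm]⟩
    obtain ⟨k, hk, h⟩ := hσ.exists_pow_eq (Finset.mem_univ b) (Finset.mem_univ a)
    rw [Finset.card_univ, hm] at hk
    exact ⟨⟨k, hk⟩, h⟩
  rw [hm, ← cycleSum_finRotate]
  refine cycleSum_conj A (Equiv.ofBijective _ hbij) fun k => ?_
  simp only [Equiv.ofBijective_apply]
  refine Fin.lastCases ?_ (fun k => ?_) k
  · have h := hσ.pow_card_apply (Finset.mem_univ b)
    rw [Finset.card_univ, hm, pow_succ'] at h
    simpa using h.symm
  · simp [pow_succ']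

lemma cycleSum_eq_prod_fiber {α K : Type*} [Fintype α] [DecidableEq α] [Fintype K] [DecidableEq K]
    (A : Matrix n n ℂ) (σ : Equiv.Perm α) (f : α → K) (hf : ∀ a, f (σ a) = f a) :
    cycleSum A σ = ∏ k, cycleSum A (σ.subtypePerm (p := fun a => f a = k) fun a => by rw [hf]) := by
  simp only [cycleSum]
  rw [Finset.prod_univ_sum, Fintype.piFinset_univ]
  refine Fintype.sum_equiv
    (((Equiv.sigmaFiberEquiv f).symm.arrowCongr (Equiv.refl n)).trans 
      (Equiv.piCurry fun (k : K) (_ : {a // f a = k}) => n)) _ _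
    fun i => ?_
  rw [← (Equiv.sigmaFiberEquiv f).prod_comp, Fintype.prod_sigma]
  rfl

lemma isCycleOn_subtypePerm_univ {α : Type*} [Fintype α] {σ : Equiv.Perm α}
    {p : α → Prop} [DecidablePred p] (hp : ∀ a, p (σ a) ↔ p a)
    (h : ∀ a b, p a → p b → σ.SameCycle a b) :
    (σ.subtypePerm hp).IsCycleOn (Finset.univ : Finset (Subtype p)) := by
  refine ⟨?_, fun a _ b _ => ?_⟩
  · simp
  · exact Equiv.Perm.sameCycle_subtypePerm.2 (h a b a.2 b.2)

lemma cycleSum_eq_prod_parts {n : Type*} [Fintype n] [DecidableEq n] {α : Type*} [Fintype α]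
    [DecidableEq α] (A : Matrix n n ℂ) (σ : Equiv.Perm α) :
    cycleSum A σ = (σ.partition.parts.map fun k => (A ^ k).trace).prod := by
  let f : α → σ.cycleFactorsFinset ⊕ {a // σ a = a} := fun a =>
    if h : σ a = a then Sum.inr ⟨a, h⟩ else
      Sum.inl ⟨σ.cycleOf a, Equiv.Perm.cycleOf_mem_cycleFactorsFinset_iff.2
        (Equiv.Perm.mem_support.2 h)⟩
  have hinl : ∀ a c, f a = Sum.inl c ↔ a ∈ (c : Equiv.Perm α).support := by
    intro a c
    by_cases h : σ a = a
    · have : a ∉ (c : Equiv.Perm α).support := fun h' =>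
        Equiv.Perm.mem_support.1 (Equiv.Perm.mem_cycleFactorsFinset_support_le c.2 h') h
      simp [f, h, this]
    · simp only [f, h, dite_false, Sum.inl.injEq, Subtype.ext_iff]
      rw [eq_comm, Equiv.Perm.eq_cycleOf_of_mem_cycleFactorsFinset_iff _ _ c.2]
  have hinr : ∀ a x, f a = Sum.inr x ↔ a = x := by
    intro a x
    by_cases h : σ a = a
    · simp [f, h, Subtype.ext_iff]
    · have : a ≠ x := fun h' => h (h' ▸ x.2)
      simp [f, h, this]
  have hf : ∀ a, f (σ a) = f a := by
    intro a
    rcases h : f a with c | x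
    · rw [hinl] at h ⊢
      have := (Equiv.Perm.isCycleOn_support_of_mem_cycleFactorsFinset c.2).apply_mem_iff (x := a)
      exact_mod_cast this.2 h
    · rw [hinr] at h ⊢
      rw [h, x.2]
  rw [cycleSum_eq_prod_fiber A σ f hf, Fintype.prod_sum_type, Equiv.Perm.parts_partition,
    Multiset.map_add, Multiset.prod_add, Multiset.map_replicate, Multiset.prod_replicate]
  congr 1
  · rw [Equiv.Perm.cycleType_def, Multiset.map_map]
    refine Eq.trans ?_ (Finset.prod_coe_sort σ.cycleFactorsFinset
      fun c => (A ^ c.support.card).trace)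
    refine Finset.prod_congr rfl fun c _ => ?_
    have hcard : Fintype.card {a // f a = Sum.inl c} = (c : Equiv.Perm α).support.card := by
      simp only [hinl, Fintype.card_coe]
    have hc := Equiv.Perm.isCycleOn_support_of_mem_cycleFactorsFinset c.2
    obtain ⟨a, ha⟩ := (Equiv.Perm.mem_cycleFactorsFinset_iff.1 c.2).1.nonempty_support
    have : Nonempty {a // f a = Sum.inl c} := ⟨⟨a, (hinl a c).2 ha⟩⟩
    rw [cycleSum_of_isCycleOn, hcard]
    refine isCycleOn_subtypePerm_univ _ fun a b ha hb => ?_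
    exact hc.2 ((hinl a c).1 ha) ((hinl b c).1 hb)
  · have hfix : Fintype.card {a // σ a = a} = Fintype.card α - σ.support.card := by
      rw [Fintype.card_subtype, ← Finset.card_compl]
      congr 1
      ext a
      simp
    rw [← hfix, ← Finset.card_univ, ← Finset.prod_const]
    refine Finset.prod_congr rfl fun x _ => ?_
    have hcard : Fintype.card {a // f a = Sum.inr x} = 1 := by
      simp only [hinr, Fintype.card_subtype_eq]
    have : Nonempty {a // f a = Sum.inr x} := ⟨⟨x, (hinr x x).2 rfl⟩⟩
    rw [cycleSum_of_isCycleOn, hcard]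
    refine isCycleOn_subtypePerm_univ _ fun a b ha hb => ?_
    rw [(hinr a x).1 ha, (hinr b x).1 hb]

end CycleTrace

lemma trace_permMat_mul_tensor {d N : ℕ} (σ : Equiv.Perm (Fin d)) (A : Matrix (Fin N) (Fin N) ℂ) :
    (permMat N σ * tensor fun _ => A).trace = pPoly A σ.partition := by
  rw [pPoly, ← cycleSum_eq_prod_parts]
  simp only [trace, diag, permMat_mul_apply, tensor_apply]
  rfl

section Counting

variable {d : ℕ}

/-- The cycle type of a permutation of `Fin d`, as a partition of `d`. -/
def cyclePartition (σ : Equiv.Perm (Fin d)) : d.Partition :=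
  ⟨σ.partition.parts, σ.partition.parts_pos, by rw [σ.partition.parts_sum, Fintype.card_fin]⟩

lemma hasCycleType_iff {σ : Equiv.Perm (Fin d)} {α : d.Partition} :
    HasCycleType σ α ↔ cyclePartition σ = α :=
  (Nat.Partition.ext_iff (x := cyclePartition σ)).symm

lemma cyclePartition_inv (σ : Equiv.Perm (Fin d)) : cyclePartition σ⁻¹ = cyclePartition σ := by
  refine Nat.Partition.ext ?_
  simp only [cyclePartition, Equiv.Perm.parts_partition, Equiv.Perm.cycleType_inv,
    Equiv.Perm.support_inv]

lemma Hnt_eq_card (α β : d.Partition) (r : ℕ) :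
    Hnt d α β r = ((Finset.univ ×ˢ monoTuples d d r).filter fun T =>
      cyclePartition (T.1⁻¹ * (List.ofFn T.2).prod) = α ∧ cyclePartition T.1 = β).card := by
  rw [Hnt, ← Fintype.card_coe, ← Nat.card_eq_fintype_card]
  refine Nat.card_congr
    { toFun := fun T => ⟨(T.1.2.1⁻¹, T.1.2.2), ?_⟩
      invFun := fun T => ⟨((T.1.1⁻¹ * (List.ofFn T.1.2).prod)⁻¹, T.1.1⁻¹, T.1.2), ?_⟩
      left_inv := ?_
      right_inv := fun T => by simp }
  · obtain ⟨⟨ρ, σ, τ⟩, h1, h2, h3, h4⟩ := T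
    rw [hasCycleType_iff] at h1 h2
    rw [mul_assoc, mul_eq_one_iff_eq_inv] at h4
    simp only [Finset.mem_filter, Finset.mem_product, Finset.mem_univ, true_and,
      mem_monoTuples_self, inv_inv, cyclePartition_inv]
    refine ⟨h3, ?_, h2⟩
    rw [← cyclePartition_inv, ← h4]
    exact h1
  · obtain ⟨⟨σ, τ⟩, h⟩ := T
    simp only [Finset.mem_filter, Finset.mem_product, Finset.mem_univ, true_and,
      mem_monoTuples_self] at h
    simp only [hasCycleType_iff, cyclePartition_inv]
    refine ⟨h.2.1, h.2.2, h.1, ?_⟩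
    rw [mul_assoc, inv_mul_cancel]
  · rintro ⟨⟨ρ, σ, τ⟩, h1, h2, h3, h4⟩
    rw [mul_assoc, mul_eq_one_iff_eq_inv] at h4
    simp only at h4
    simp [h4]

lemma Hnt_le (α β : d.Partition) (r : ℕ) :
    Hnt d α β r ≤ Fintype.card (Equiv.Perm (Fin d)) * (monoTuples d d r).card := by
  rw [Hnt_eq_card]
  refine (Finset.card_filter_le _ _).trans ?_
  rw [Finset.card_product, Finset.card_univ]

lemma summable_norm_Hnt {N : ℕ} (hdN : d ≤ N) (α β : d.Partition) :
    Summable fun r : ℕ => ‖(-(1 : ℂ) / N) ^ r * (Hnt d α β r : ℂ)‖ := by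
  refine Summable.of_nonneg_of_le (fun r => norm_nonneg _) (fun r => ?_)
    ((summable_card_monoTuples le_rfl (by positivity) (natCast_mul_inv_lt hdN)).mul_left
      (Fintype.card (Equiv.Perm (Fin d)) : ℝ))
  rw [norm_mul, norm_pow, norm_neg_one_div, Complex.norm_natCast, mul_left_comm]
  exact mul_le_mul_of_nonneg_left (by exact_mod_cast Hnt_le α β r) (by positivity)

lemma sum_mul_Hnt (f g : d.Partition → ℂ) (r : ℕ) :
    ∑ α, ∑ β, f α * g β * (Hnt d α β r : ℂ)
      = ∑ σ : Equiv.Perm (Fin d), g (cyclePartition σ) *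
          ∑ τ ∈ monoTuples d d r, f (cyclePartition (σ⁻¹ * (List.ofFn τ).prod)) := by
  have h : ∀ α β : d.Partition, (Hnt d α β r : ℂ) = ∑ σ : Equiv.Perm (Fin d),
      ∑ τ ∈ monoTuples d d r,
        if cyclePartition (σ⁻¹ * (List.ofFn τ).prod) = α ∧ cyclePartition σ = β then 1 else 0 := by
    intro α β
    rw [Hnt_eq_card, Finset.natCast_card_filter, Finset.sum_product]
  simp only [h, Finset.mul_sum]
  simp_rw [Finset.sum_comm (s := (Finset.univ : Finset d.Partition))
    (t := (Finset.univ : Finset (Equiv.Perm (Fin d))))]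
  refine Finset.sum_congr rfl fun σ _ => ?_
  simp_rw [Finset.sum_comm (s := (Finset.univ : Finset d.Partition)) (t := monoTuples d d r)]
  refine Finset.sum_congr rfl fun τ _ => ?_
  simp [ite_and, mul_comm]

end Counting

section Moment

variable {d N : ℕ}

lemma trace_tensor (M : Fin d → Matrix (Fin N) (Fin N) ℂ) :
    (tensor M).trace = ∏ k, (M k).trace := by
  simp only [trace, diag, tensor_apply]
  rw [Finset.prod_univ_sum, Fintype.piFinset_univ]

lemma tensorPow_self (U : Matrix (Fin N) (Fin N) ℂ) : tensorPow d d U = tensor fun _ => U := by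
  simp [tensorPow]

lemma integral_trace_pow (μ : Measure (unitaryGroup (Fin N) ℂ)) [IsProbabilityMeasure μ]
    (A B : Matrix (Fin N) (Fin N) ℂ) :
    ∫ U : unitaryGroup (Fin N) ℂ, ((A * (U : Matrix (Fin N) (Fin N) ℂ) * B *
        ((U⁻¹ : unitaryGroup (Fin N) ℂ) : Matrix (Fin N) (Fin N) ℂ)).trace) ^ d ∂μ
      = ((tensor fun _ : Fin d => A) * twirl μ d (tensor fun _ => B)).trace := by
  have h := linearMap_matInt μ (continuous_conj_tensorPow d (tensor fun _ => B))
    (traceLinearMap (Fin d → Fin N) ℂ ℂ ∘ₗ LinearMap.mulLeft ℂ (tensor fun _ => A))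
  simp only [LinearMap.comp_apply, LinearMap.mulLeft_apply, traceLinearMap_apply] at h
  rw [twirl, h]
  refine integral_congr_ae (Filter.Eventually.of_forall fun U => ?_)
  simp [tensorPow_self, tensor_mul, trace_tensor, mul_assoc]

lemma natCast_pow_smul_twirl (μ : Measure (unitaryGroup (Fin N) ℂ)) [IsProbabilityMeasure μ]
    [μ.IsHaarMeasure] (hd : d ≤ N) (hN : N ≠ 0)
    (B : Matrix (Fin d → Fin N) (Fin d → Fin N) ℂ) :
    (N : ℂ) ^ d • twirl μ d B = ∑ σ : Equiv.Perm (Fin d), (permMat N σ * B).trace •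
      (permMat N σ⁻¹ * ∑' r, (-(1 : ℂ) / N) ^ r • monoSum d N d r) := by
  have h := congrArg (· * ∑' r, (-(1 : ℂ) / N) ^ r • monoSum d N d r)
    (twirl_mul_jucysProd_self μ B)
  simpa only [mul_assoc, jucysProd_mul_tsum_monoSum hd hN, mul_smul_comm, mul_one,
    Finset.sum_mul, smul_mul_assoc] using h

lemma hasSum_trace_mul_tsum_monoSum (hd : d ≤ N) (A : Matrix (Fin N) (Fin N) ℂ)
    (σ : Equiv.Perm (Fin d)) :
    HasSum (fun r => (-(1 : ℂ) / N) ^ r *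
        ∑ τ ∈ monoTuples d d r, pPoly A (cyclePartition (σ * (List.ofFn τ).prod)))
      ((tensor fun _ : Fin d => A) *
        (permMat N σ * ∑' r, (-(1 : ℂ) / N) ^ r • monoSum d N d r)).trace := by
  let φ : Matrix (Fin d → Fin N) (Fin d → Fin N) ℂ →ₗ[ℂ] ℂ := traceLinearMap (Fin d → Fin N) ℂ ℂ ∘ₗ
    LinearMap.mulLeft ℂ (tensor fun _ => A) ∘ₗ LinearMap.mulLeft ℂ (permMat N σ)
  have hφ : Continuous φ :=
    (Continuous.matrix_mul continuous_const
      (continuous_const.matrix_mul continuous_id)).matrix_trace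
  have h := (summable_monoSum (d := d) le_rfl hd).hasSum.map φ hφ
  refine h.congr_fun fun r => ?_
  simp only [Function.comp_apply, map_smul, smul_eq_mul, monoSum, map_sum]
  congr 1
  refine Finset.sum_congr rfl fun τ _ => ?_
  simp only [φ, LinearMap.comp_apply, LinearMap.mulLeft_apply, traceLinearMap_apply]
  rw [trace_mul_comm, ← permMat_mul, trace_permMat_mul_tensor]
  rfl

lemma trace_mul_twirl (μ : Measure (unitaryGroup (Fin N) ℂ)) [IsProbabilityMeasure μ]
    [μ.IsHaarMeasure] (hd : d ≤ N) (hN : N ≠ 0) (A B : Matrix (Fin N) (Fin N) ℂ) :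
    ((tensor fun _ : Fin d => A) * twirl μ d (tensor fun _ => B)).trace
      = ((N : ℂ) ^ d)⁻¹ * ∑ α : d.Partition, ∑ β : d.Partition,
          pPoly A α * pPoly B β * ∑' r : ℕ, (-(1 : ℂ) / N) ^ r * (Hnt d α β r : ℂ) := by
  rw [eq_inv_mul_iff_mul_eq₀ (pow_ne_zero _ (Nat.cast_ne_zero.2 hN)), ← smul_eq_mul,
    ← trace_smul, ← mul_smul_comm, natCast_pow_smul_twirl μ hd hN, Finset.mul_sum, trace_sum]
  simp only [mul_smul_comm, trace_smul, smul_eq_mul, trace_permMat_mul_tensor]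
  have h1 := hasSum_sum (s := Finset.univ) fun (σ : Equiv.Perm (Fin d)) _ =>
    (hasSum_trace_mul_tsum_monoSum hd A σ⁻¹).mul_left (pPoly B σ.partition)
  have h2 := hasSum_sum (s := Finset.univ) fun (α : d.Partition) _ =>
    hasSum_sum (s := Finset.univ) fun (β : d.Partition) _ =>
      (summable_norm_Hnt hd α β).of_norm.hasSum.mul_left (pPoly A α * pPoly B β)
  refine h1.unique (h2.congr_fun fun r => ?_)
  have h3 := sum_mul_Hnt (d := d) (pPoly A) (pPoly B) r
  simp only [mul_left_comm _ ((-(1 : ℂ) / N) ^ r), ← Finset.mul_sum, h3]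
  rfl

end Moment

/-- Exact evaluation of the moments of the HCIZ model:
`∫ (Tr(AUBU⁻¹))^d dκ_N = N^{-d} ∑_{α,β⊢d} p_α(A) p_β(B) ∑_r (-1/N)^r H̃^r(α,β)`,
for `1 ≤ d ≤ N`, with absolutely convergent inner series. -/
theorem hciz_moment (N : ℕ) (hN : 1 ≤ N)
    (μ : Measure (Matrix.unitaryGroup (Fin N) ℂ))
    (hμ : μ.IsHaarMeasure) (hμprob : IsProbabilityMeasure μ)
    (A B : Matrix (Fin N) (Fin N) ℂ)
    (hA : IsStarNormal A) (hB : IsStarNormal B)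
    (d : ℕ) (hd1 : 1 ≤ d) (hdN : d ≤ N) :
    (∀ α β : Nat.Partition d,
      Summable fun r : ℕ => ‖(-(1 : ℂ) / N) ^ r * (Hnt d α β r : ℂ)‖) ∧
    ∫ U : Matrix.unitaryGroup (Fin N) ℂ,
        ((A * (U : Matrix (Fin N) (Fin N) ℂ) * B *
          ((U⁻¹ : Matrix.unitaryGroup (Fin N) ℂ) : Matrix (Fin N) (Fin N) ℂ)).trace) ^ d ∂μ
      = ((N : ℂ) ^ d)⁻¹ * ∑ α : Nat.Partition d, ∑ β : Nat.Partition d,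
          pPoly A α * pPoly B β *
            ∑' r : ℕ, (-(1 : ℂ) / N) ^ r * (Hnt d α β r : ℂ) := by
  refine ⟨fun α β => summable_norm_Hnt hdN α β, ?_⟩
  have := hμ
  rw [integral_trace_pow, trace_mul_twirl μ hdN (Nat.one_le_iff_ne_zero.1 hN)]

end HCIZ
end
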